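/- arXiv:1712.04781 — 6 statements merged into one kernel-verified Lean document; each statement's English description precedes it below -/
import Mathlib

section
/- Let R be a ring and let M be a right R-module fitting into a short exact sequence 0 → M → C → M → 0 where C ∈ ℬ_∞, i.e. Ext^1_R(F, C) = 0 for every module F that is a filtered colimit of modules of finite projective dimension admitting resolutions by finitely generated projective modules. Then M ∈ ℬ_∞, i.e. Ext^1_R(F, M) = 0 for every such module F. -/
open CategoryTheory CategoryTheory.Limits CategoryTheory.Abelian ZeroObject

universe w' w v u

/-- There is a short exact sequence `0 → X → Y → Z → 0` in the abelian category `C`. -/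
def IsShortExactSeq {C : Type u} [Category.{v} C] [Abelian C] (X Y Z : C) : Prop :=
  ∃ (f : X ⟶ Y) (g : Y ⟶ Z) (w : f ≫ g = 0), (ShortComplex.mk f g w).ShortExact

/-- `(𝒜, ℬ)` is a cotorsion pair in the abelian category `C`:
each class is the `Ext¹`-orthogonal of the other. -/
structure IsCotorsionPair (C : Type u) [Category.{v} C] [Abelian C] [HasExt.{w} C]
    (𝒜 ℬ : Set C) : Prop where
  mem_left_iff : ∀ X : C, X ∈ 𝒜 ↔ ∀ B ∈ ℬ, Subsingleton (Abelian.Ext.{w} X B 1)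
  mem_right_iff : ∀ Y : C, Y ∈ ℬ ↔ ∀ A ∈ 𝒜, Subsingleton (Abelian.Ext.{w} A Y 1)

/-- `(𝒜, ℬ)` is a complete cotorsion pair: every object has a special `ℬ`-preenvelope
`0 → M → B → A → 0` and a special `𝒜`-precover `0 → B' → A' → M → 0`. -/
structure IsCompleteCotorsionPair (C : Type u) [Category.{v} C] [Abelian C] [HasExt.{w} C]
    (𝒜 ℬ : Set C) extends IsCotorsionPair C 𝒜 ℬ : Prop where
  preenvelope : ∀ M : C, ∃ B A, B ∈ ℬ ∧ A ∈ 𝒜 ∧ IsShortExactSeq M B A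
  precover : ∀ M : C, ∃ B A, B ∈ ℬ ∧ A ∈ 𝒜 ∧ IsShortExactSeq B A M

/-- `(𝒜, ℬ)` is a complete hereditary cotorsion pair:
moreover `Ext^i(A, B) = 0` for all `A ∈ 𝒜`, `B ∈ ℬ` and `i ≥ 1`. -/
structure IsCompleteHereditaryCotorsionPair (C : Type u) [Category.{v} C] [Abelian C]
    [HasExt.{w} C] (𝒜 ℬ : Set C) extends IsCompleteCotorsionPair C 𝒜 ℬ : Prop where
  hereditary : ∀ A ∈ 𝒜, ∀ B ∈ ℬ, ∀ i : ℕ, 1 ≤ i → Subsingleton (Abelian.Ext.{w} A B i)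

/-- `M` has finite projective dimension. -/
def HasFinProjDim (R : Type u) [Ring R] [HasExt.{w} (ModuleCat.{u} Rᵐᵒᵖ)]
    (M : ModuleCat.{u} Rᵐᵒᵖ) : Prop :=
  ∃ n : ℕ, ∀ (N : ModuleCat.{u} Rᵐᵒᵖ) (i : ℕ), n < i → Subsingleton (Abelian.Ext.{w} M N i)

/-- `M` admits a projective resolution all of whose terms are finitely generated
(projective) modules. -/
def HasFgProjResolution (R : Type u) [Ring R] (M : ModuleCat.{u} Rᵐᵒᵖ) : Prop :=
  ∃ P : ProjectiveResolution M, ∀ k : ℕ, Module.Finite Rᵐᵒᵖ (P.complex.X k)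

/-- `M ∈ P(mod-R)`: `M` has finite projective dimension and admits a projective resolution
with finitely generated projective terms. -/
def MemPModR (R : Type u) [Ring R] [HasExt.{w} (ModuleCat.{u} Rᵐᵒᵖ)]
    (M : ModuleCat.{u} Rᵐᵒᵖ) : Prop :=
  HasFinProjDim R M ∧ HasFgProjResolution R M

/-- `F` is a colimit of a filtered diagram of shape `J` of modules in `P(mod-R)`. -/
def MemAInftyAux (R : Type u) [Ring R] [HasExt.{w} (ModuleCat.{u} Rᵐᵒᵖ)]
    (F : ModuleCat.{u} Rᵐᵒᵖ) (J : Type u) [hJ : SmallCategory J] : Prop :=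
  IsFiltered J ∧ ∃ (D : J ⥤ ModuleCat.{u} Rᵐᵒᵖ) (c : Cocone D),
    (∀ j : J, MemPModR R (D.obj j)) ∧ Nonempty (IsColimit c) ∧ Nonempty (c.pt ≅ F)

/-- `F ∈ 𝒜^∞`: `F` is a filtered colimit of modules in `P(mod-R)`. -/
def MemAInfty (R : Type u) [Ring R] [HasExt.{w} (ModuleCat.{u} Rᵐᵒᵖ)]
    (F : ModuleCat.{u} Rᵐᵒᵖ) : Prop :=
  ∃ (J : Type u) (hJ : SmallCategory J), MemAInftyAux R F J (hJ := hJ)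

universe v' u'

/-- Every linear map `X → C` lifts along `p : I → C`. When `p` is the cokernel of an embedding of
`N` into an injective module `I`, this says that `Ext¹(X, N) = 0`. -/
def LiftsAlong {A : Type u} [Ring A] {I C : Type u} [AddCommGroup I] [Module A I] [AddCommGroup C]
    [Module A C] (p : I →ₗ[A] C) (X : Type u) [AddCommGroup X] [Module A X] : Prop :=
  ∀ f : X →ₗ[A] C, ∃ g : X →ₗ[A] I, p ∘ₗ g = f

section Lifting

variable {A : Type u} [Ring A] {I C : Type u} [AddCommGroup I] [Module A I] [AddCommGroup C]
  [Module A C] {p : I →ₗ[A] C}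

lemma LiftsAlong.of_subsingleton (X : Type u) [AddCommGroup X] [Module A X] [Subsingleton X] :
    LiftsAlong p X := fun f ↦ ⟨0, by
  ext x
  rw [Subsingleton.elim x 0, map_zero, map_zero]⟩

open DirectSum in
lemma LiftsAlong.directSum {W : Type u} [DecidableEq W] {G : W → Type u}
    [∀ w, AddCommGroup (G w)] [∀ w, Module A (G w)] (hG : ∀ w, LiftsAlong p (G w)) :
    LiftsAlong p (⨁ w, G w) := by
  intro f
  choose g hg using fun w ↦ hG w (f ∘ₗ DirectSum.lof A W G w)
  refine ⟨DirectSum.toModule A W I g, DirectSum.linearMap_ext _ fun w ↦ ?_⟩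
  rw [← hg w]
  ext x
  simp

/-- A lift defined on `S` extends to `T ≥ S` if `T ⧸ S` has the lifting property. -/
lemma LiftsAlong.exists_extend [Module.Injective A I] {K X : Type u} [AddCommGroup K] [Module A K]
    [AddCommGroup X] [Module A X] (hX : LiftsAlong p X) (f : K →ₗ[A] C)
    {S T : Submodule A K} (hST : S ≤ T) (q : T →ₗ[A] X) (hq : Function.Surjective q)
    (hker : LinearMap.ker q ≤ S.submoduleOf T) (hker' : S.submoduleOf T ≤ LinearMap.ker q)
    (g : S →ₗ[A] I) (hg : p ∘ₗ g = f ∘ₗ S.subtype) :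
    ∃ g' : T →ₗ[A] I, p ∘ₗ g' = f ∘ₗ T.subtype ∧ g' ∘ₗ Submodule.inclusion hST = g := by
  obtain ⟨g₀, hg₀⟩ := Module.Injective.out (Submodule.inclusion hST)
    (Submodule.inclusion_injective hST) g
  have hd : LinearMap.ker q ≤ LinearMap.ker (f ∘ₗ T.subtype - p ∘ₗ g₀) := by
    intro x hx
    have hxS : (x : K) ∈ S := hker hx
    have h1 := hg₀ ⟨x, hxS⟩
    have h2 := LinearMap.congr_fun hg ⟨x, hxS⟩
    have h3 : Submodule.inclusion hST ⟨x, hxS⟩ = x := rfl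
    rw [h3] at h1
    simp only [LinearMap.coe_comp, Function.comp_apply, Submodule.subtype_apply] at h2
    simp [h1, h2]
  let e := q.quotKerEquivOfSurjective hq
  obtain ⟨l, hl⟩ := hX (((LinearMap.ker q).liftQ _ hd) ∘ₗ e.symm.toLinearMap)
  have hl' : ∀ x : T, p (l (q x)) = f x - p (g₀ x) := by
    intro x
    have h1 := LinearMap.congr_fun hl (q x)
    have h2 : e.symm (q x) = (LinearMap.ker q).mkQ x := by
      rw [LinearEquiv.symm_apply_eq]
      rfl
    simp only [LinearMap.coe_comp, Function.comp_apply, LinearEquiv.coe_coe, h2] at h1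
    simpa using h1
  refine ⟨g₀ + l ∘ₗ q, ?_, ?_⟩
  · ext x
    simp [hl']
  · ext x
    have : q (Submodule.inclusion hST x) = 0 := hker' x.2
    simp [this, hg₀]

/-- Eklof's lemma: the lifting property passes to modules filtered by modules with the lifting
property. -/
lemma LiftsAlong.of_filtration [Module.Injective A I] {K W : Type u} [AddCommGroup K] [Module A K]
    [LinearOrder W] [WellFoundedLT W] (L : W → Submodule A K)
    (htop : ⨆ w, L w = ⊤)
    (hL : ∀ w, ∃ (X : Type u) (_ : AddCommGroup X) (_ : Module A X) (q : L w →ₗ[A] X),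
      LiftsAlong p X ∧ Function.Surjective q ∧
        ∀ x, q x = 0 ↔ (x : K) ∈ ⨆ v : Set.Iio w, L v) (hmono : Monotone L) :
    LiftsAlong p K := by
  intro f
  let 𝒮 : Set (K →ₗ.[A] I) := {g | (∃ s : LowerSet W, g.domain = ⨆ v : s, L v) ∧
    ∀ x : g.domain, p (g x) = f x}
  have hzorn : ∀ c ⊆ 𝒮, IsChain (· ≤ ·) c → ∀ y ∈ c, ∃ ub ∈ 𝒮, ∀ z ∈ c, z ≤ ub := by
    intro c hc hchain y hy
    have hdir : DirectedOn (· ≤ ·) c := hchain.directedOn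
    refine ⟨LinearPMap.sSup c hdir, ⟨?_, ?_⟩, fun z hz ↦ LinearPMap.le_sSup hdir hz⟩
    · choose! s hs using fun g hg ↦ (hc (a := g) hg).1
      refine ⟨⨆ g : c, s g, ?_⟩
      rw [LinearPMap.domain_sSup]
      apply le_antisymm
      · refine sSup_le ?_
        rintro _ ⟨g, hg, rfl⟩
        rw [hs g hg]
        refine iSup_le fun v ↦ ?_
        exact le_iSup_of_le (f := fun v : (⨆ g : c, s g : LowerSet W) ↦ L v)
          ⟨v, le_iSup (fun g : c ↦ s g) ⟨g, hg⟩ v.2⟩ le_rfl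
      · refine iSup_le fun ⟨v, hv⟩ ↦ ?_
        rw [LowerSet.mem_iSup_iff] at hv
        obtain ⟨⟨g, hg⟩, hv⟩ := hv
        refine le_trans ?_ (le_sSup ⟨g, hg, rfl⟩)
        rw [hs g hg]
        exact le_iSup (fun v : s g ↦ L v) ⟨v, hv⟩
    · rintro ⟨x, hx⟩
      obtain ⟨g, hg, hxg⟩ := (LinearPMap.mem_domain_sSup_iff ⟨y, hy⟩ hdir).1 hx
      have := LinearPMap.sSup_apply hdir hg ⟨x, hxg⟩
      rw [← (hc hg).2 ⟨x, hxg⟩, ← this]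
  have hbot : (⟨⊥, 0⟩ : K →ₗ.[A] I) ∈ 𝒮 := by
    refine ⟨⟨⊥, ?_⟩, ?_⟩
    · rw [eq_comm, iSup_eq_bot]
      rintro ⟨v, hv⟩
      exact absurd hv (by simp)
    · rintro ⟨x, hx⟩
      obtain rfl : x = 0 := hx
      simp
  obtain ⟨g, -, hg⟩ := zorn_le_nonempty₀ 𝒮 hzorn _ hbot
  obtain ⟨⟨s, hs⟩, hgf⟩ := hg.prop
  have hdomain : ∀ w, L w ≤ g.domain := by
    intro w
    induction w using WellFoundedLT.induction with
    | ind w ih =>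
    by_cases hw : w ∈ s
    · rw [hs]
      exact le_iSup (fun v : s ↦ L v) ⟨w, hw⟩
    have hdom : g.domain = ⨆ v : Set.Iio w, L v := by
      apply le_antisymm
      · rw [hs]
        refine iSup_le fun v ↦ ?_
        refine le_iSup (fun v : Set.Iio w ↦ L v) ⟨v, ?_⟩
        by_contra hv
        exact hw (s.lower (not_lt.1 hv) v.2)
      · exact iSup_le fun v ↦ ih v v.2
    obtain ⟨X, _, _, q, hX, hq, hker⟩ := hL w
    have hle : g.domain ≤ L w := by
      rw [hdom]
      exact iSup_le fun v ↦ hmono (le_of_lt v.2)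
    obtain ⟨g', hg', hext⟩ := hX.exists_extend f hle q hq
      (fun x hx ↦ by
        change (x : K) ∈ g.domain
        rw [hdom]
        exact (hker x).1 hx)
      (fun x hx ↦ (hker x).2 (by
        rw [← hdom]
        exact hx)) g.toFun (by
        ext x
        exact hgf x)
    have hmem : (⟨L w, g'⟩ : K →ₗ.[A] I) ∈ 𝒮 := by
      refine ⟨⟨LowerSet.Iic w, le_antisymm ?_ ?_⟩, fun x ↦ LinearMap.congr_fun hg' x⟩
      · exact le_iSup (fun v : LowerSet.Iic w ↦ L v) ⟨w, le_rfl⟩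
      · exact iSup_le fun v ↦ hmono v.2
    have hgg' : g ≤ ⟨L w, g'⟩ := by
      refine ⟨hle, ?_⟩
      rintro x y hxy
      have h1 := LinearMap.congr_fun hext x
      have h2 : Submodule.inclusion hle x = y := Subtype.ext hxy
      rw [LinearMap.comp_apply, h2] at h1
      exact h1.symm
    exact (hg.2 hmem hgg').1
  have hdtop : g.domain = ⊤ := by
    exact top_le_iff.1 (htop ▸ iSup_le hdomain)
  refine ⟨g.toFun ∘ₗ LinearMap.codRestrict g.domain LinearMap.id (fun x ↦ by simp [hdtop]), ?_⟩
  ext x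
  exact hgf ⟨x, _⟩

end Lifting

section Telescope

open DirectSum

variable {A : Type u} [Ring A]

lemma DirectSum.apply_eq_of_components {W : Type u} [DecidableEq W] {G : W → Type u}
    [∀ w, AddCommGroup (G w)] [∀ w, Module A (G w)] {Z : Type u} [AddCommGroup Z] [Module A Z]
    (φ ψ : (⨁ w, G w) →ₗ[A] Z) (x : ⨁ w, G w)
    (h : ∀ w, φ (lof A W G w (x w)) = ψ (lof A W G w (x w))) : φ x = ψ x := by
  classical
  rw [← DirectSum.sum_support_of x, map_sum, map_sum]
  exact Finset.sum_congr rfl fun w _ ↦ h w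

variable {I C : Type u} [AddCommGroup I] [Module A I] [AddCommGroup C] [Module A C]
  {p : I →ₗ[A] C} {W : Type u} [LinearOrder W] {G : W → Type u}
  [∀ w, AddCommGroup (G w)] [∀ w, Module A (G w)]

open Classical in
/-- The map `⨁ w, G w → Z` which is `h v` on `G v` if `v ∈ s`, and zero otherwise. -/
noncomputable def DirectSum.partialSum {Z : Type u} [AddCommGroup Z] [Module A Z] (s : Set W)
    (h : ∀ v ∈ s, G v →ₗ[A] Z) : (⨁ w, G w) →ₗ[A] Z :=
  DirectSum.toModule A W Z fun v ↦ if hv : v ∈ s then h v hv else 0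

lemma DirectSum.partialSum_lof {Z : Type u} [AddCommGroup Z] [Module A Z] {s : Set W}
    (h : ∀ v ∈ s, G v →ₗ[A] Z) {v : W} (hv : v ∈ s) (x : G v) :
    partialSum s h (lof A W G v x) = h v hv x := by
  simp [partialSum, hv]

lemma DirectSum.partialSum_lof_of_notMem {Z : Type u} [AddCommGroup Z] [Module A Z] {s : Set W}
    (h : ∀ v ∈ s, G v →ₗ[A] Z) {v : W} (hv : v ∉ s) (x : G v) :
    partialSum s h (lof A W G v x) = 0 := by
  simp [partialSum, hv]

variable (g : ∀ v w, v ≤ w → G v →ₗ[A] G w)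

/-- The elements of `⨁ w, G w` supported on `v ≤ w` whose image in `G w` is zero. -/
noncomputable def telescopeKer (w : W) : Submodule A (⨁ w, G w) where
  carrier := {x | (∀ v, w < v → x v = 0) ∧ partialSum (Set.Iic w) (fun v hv ↦ g v w hv) x = 0}
  add_mem' := by
    rintro x y ⟨hx, hx'⟩ ⟨hy, hy'⟩
    exact ⟨fun v hv ↦ by rw [DirectSum.add_apply, hx v hv, hy v hv, add_zero],
      by rw [map_add, hx', hy', add_zero]⟩
  zero_mem' := ⟨fun v _ ↦ rfl, map_zero _⟩
  smul_mem' := by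
    rintro a x ⟨hx, hx'⟩
    exact ⟨fun v hv ↦ by rw [DirectSum.smul_apply, hx v hv, smul_zero],
      by rw [map_smul, hx', smul_zero]⟩

/-- A cocone `c` on the directed system `(G, g)`, restricted to an index set `s`, with the property
that an element of `G v` killed by the cocone is killed by some transition map. -/
structure IsMonoCocone {F : Type u} [AddCommGroup F] [Module A F] (s : Set W)
    (c : ∀ v ∈ s, G v →ₗ[A] F) : Prop where
  comp : ∀ v w (hv : v ∈ s) (hw : w ∈ s) (h : v ≤ w) x, c w hw (g v w h x) = c v hv x
  exists_eq_zero : ∀ v (hv : v ∈ s) x, c v hv x = 0 → ∃ w ∈ s, ∃ h : v ≤ w, g v w h x = 0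

variable {g}
lemma partialSum_eq_of_le
    (g_comp : ∀ u v w (huv : u ≤ v) (hvw : v ≤ w) x,
      g v w hvw (g u v huv x) = g u w (huv.trans hvw) x)
    {v w : W} (hvw : v ≤ w) (x : ⨁ w, G w)
    (hx : ∀ u, v < u → u ≤ w → x u = 0) :
    partialSum (Set.Iic w) (fun v hv ↦ g v w hv) x =
      g v w hvw (partialSum (Set.Iic v) (fun u hu ↦ g u v hu) x) := by
  refine apply_eq_of_components _ (g v w hvw ∘ₗ partialSum _ _) x fun u ↦ ?_
  rw [LinearMap.comp_apply]
  by_cases huv : u ≤ v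
  · rw [partialSum_lof _ (show u ∈ Set.Iic v from huv),
      partialSum_lof _ (show u ∈ Set.Iic w from huv.trans hvw), g_comp]
  · rw [partialSum_lof_of_notMem _ (show u ∉ Set.Iic v from huv), map_zero]
    by_cases huw : u ≤ w
    · rw [hx u (not_le.1 huv) huw, map_zero, map_zero]
    · rw [partialSum_lof_of_notMem _ (show u ∉ Set.Iic w from huw)]

lemma IsMonoCocone.partialSum_eq {F : Type u} [AddCommGroup F] [Module A F] {s : Set W}
    {c : ∀ v ∈ s, G v →ₗ[A] F} (hc : IsMonoCocone g s c) (hs : IsLowerSet s) {v : W} (hv : v ∈ s)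
    (x : ⨁ w, G w) (hx : ∀ u ∈ s, v < u → x u = 0) :
    partialSum s c x = c v hv (partialSum (Set.Iic v) (fun u hu ↦ g u v hu) x) := by
  refine apply_eq_of_components _ (c v hv ∘ₗ partialSum _ _) x fun u ↦ ?_
  rw [LinearMap.comp_apply]
  by_cases huv : u ≤ v
  · rw [partialSum_lof _ (show u ∈ Set.Iic v from huv), partialSum_lof _ (hs huv hv),
      hc.comp u v (hs huv hv) hv huv]
  · rw [partialSum_lof_of_notMem _ (show u ∉ Set.Iic v from huv), map_zero]
    by_cases hus : u ∈ s
    · rw [hx u hus (not_le.1 huv), map_zero, map_zero]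
    · rw [partialSum_lof_of_notMem _ hus]

/-- The elements killed by a cocone with the property `IsMonoCocone` are killed at some stage. -/
lemma IsMonoCocone.exists_partialSum_eq_zero
    (g_comp : ∀ u v w (huv : u ≤ v) (hvw : v ≤ w) x,
      g v w hvw (g u v huv x) = g u w (huv.trans hvw) x)
    {F : Type u} [AddCommGroup F] [Module A F] {s : Set W}
    {c : ∀ v ∈ s, G v →ₗ[A] F} (hc : IsMonoCocone g s c) (hs : IsLowerSet s) (hs' : s.Nonempty)
    (x : ⨁ w, G w) (hx : partialSum s c x = 0) :
    ∃ v ∈ s, (∀ u ∈ s, v < u → x u = 0) ∧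
      partialSum (Set.Iic v) (fun u hu ↦ g u v hu) x = 0 := by
  classical
  obtain ⟨v₀, hv₀⟩ := hs'
  let t := insert v₀ (x.support.filter (· ∈ s))
  have ht : t.Nonempty := Finset.insert_nonempty _ _
  have hv : t.max' ht ∈ s := by
    have := t.max'_mem ht
    simp only [t, Finset.mem_insert, Finset.mem_filter] at this
    rcases this with h | h
    · rwa [h]
    · exact h.2
  set v := t.max' ht
  have hxv : ∀ u ∈ s, v < u → x u = 0 := by
    intro u hu hvu
    by_contra hne
    refine not_le.2 hvu (t.le_max' u ?_)
    simp only [t, Finset.mem_insert, Finset.mem_filter, DFinsupp.mem_support_toFun]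
    exact Or.inr ⟨hne, hu⟩
  rw [hc.partialSum_eq hs hv x hxv] at hx
  obtain ⟨w, hw, hvw, h⟩ := hc.exists_eq_zero _ _ _ hx
  refine ⟨w, hw, fun u hu hwu ↦ hxv u hu (hvw.trans_lt hwu), ?_⟩
  rw [partialSum_eq_of_le g_comp hvw x fun u huv huw ↦ hxv u (hs huw hw) huv, h]

/-- The kernel of the canonical map from the direct sum of a well-ordered system to its colimit
is filtered by the colimits of the initial segments of the system. -/
lemma LiftsAlong.ker_partialSum
    (g_comp : ∀ u v w (huv : u ≤ v) (hvw : v ≤ w) x,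
      g v w hvw (g u v huv x) = g u w (huv.trans hvw) x)
    (g_refl : ∀ v x, g v v le_rfl x = x)
    [Module.Injective A I] [WellFoundedLT W] [Nonempty W]
    {F : Type u} [AddCommGroup F] [Module A F] (c : ∀ v ∈ Set.univ, G v →ₗ[A] F)
    (hc : IsMonoCocone g Set.univ c)
    (hH : ∀ w, (Set.Iio w).Nonempty → ∃ (H : Type u) (_ : AddCommGroup H) (_ : Module A H)
      (h : ∀ v ∈ Set.Iio w, G v →ₗ[A] H), IsMonoCocone g (Set.Iio w) h ∧
        (∀ y, ∃ v, ∃ hv : v ∈ Set.Iio w, ∃ x, h v hv x = y) ∧ LiftsAlong p H) :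
    LiftsAlong p (LinearMap.ker (partialSum Set.univ c)) := by
  have hmono : Monotone (telescopeKer g) := by
    intro v w hvw x hx
    refine ⟨fun u hu ↦ hx.1 u (hvw.trans_lt hu), ?_⟩
    rw [partialSum_eq_of_le g_comp hvw x fun u hu _ ↦ hx.1 u hu, hx.2, map_zero]
  refine LiftsAlong.of_filtration
    (fun w ↦ (telescopeKer g w).comap (LinearMap.ker (partialSum Set.univ c)).subtype) ?_ ?_ ?_
  · rw [eq_top_iff]
    rintro ⟨x, hx⟩ -
    obtain ⟨v, -, hv, hv'⟩ := IsMonoCocone.exists_partialSum_eq_zero g_comp hc isLowerSet_univ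
      Set.univ_nonempty x hx
    exact Submodule.mem_iSup_of_mem v ⟨fun u hu ↦ hv u trivial hu, hv'⟩
  · intro w
    by_cases hw : (Set.Iio w).Nonempty
    · obtain ⟨H, _, _, h, hh, hsurj, hlift⟩ := hH w hw
      refine ⟨H, inferInstance, inferInstance,
        partialSum (Set.Iio w) h ∘ₗ Submodule.subtype _ ∘ₗ Submodule.subtype _, hlift, ?_, ?_⟩
      · intro y
        obtain ⟨v, hv, x, rfl⟩ := hsurj y
        have hv' : v < w := hv
        let z : ⨁ w, G w := lof A W G v x - lof A W G w (g v w hv'.le x)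
        have hzw : z ∈ telescopeKer g w := by
          constructor
          · intro u hu
            have h1 : v ≠ u := (hv'.trans hu).ne
            have h2 : w ≠ u := hu.ne
            simp [z, DirectSum.lof_eq_of, DirectSum.of_eq_of_ne, h1.symm, h2.symm]
          · rw [map_sub, partialSum_lof _ (show v ∈ Set.Iic w from hv'.le),
              partialSum_lof _ (show w ∈ Set.Iic w from le_rfl), g_refl, sub_self]
        have hz : partialSum Set.univ c z = 0 := by
          rw [hc.partialSum_eq isLowerSet_univ (Set.mem_univ w) z fun u _ hu ↦ hzw.1 u hu, hzw.2,
            map_zero]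
        refine ⟨⟨⟨z, hz⟩, hzw⟩, ?_⟩
        change partialSum (Set.Iio w) h z = _
        rw [map_sub, partialSum_lof _ hv, partialSum_lof_of_notMem _ (by simp), sub_zero]
      · rintro ⟨⟨x, hx⟩, hxw⟩
        replace hxw : x ∈ telescopeKer g w := hxw
        change partialSum (Set.Iio w) h x = 0 ↔ _
        constructor
        · intro hx0
          obtain ⟨v, hv, hxv, hv'⟩ := IsMonoCocone.exists_partialSum_eq_zero g_comp hh
            (isLowerSet_Iio w) hw x hx0
          have hxw0 : x w = 0 := by
            have := apply_eq_of_components (partialSum (Set.Iic w) (fun v hv ↦ g v w hv))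
              (g v w (le_of_lt hv) ∘ₗ partialSum (Set.Iic v) (fun u hu ↦ g u v hu) +
                DirectSum.component A W G w) x ?_
            · rw [hxw.2, LinearMap.add_apply, LinearMap.comp_apply, hv', map_zero, zero_add] at this
              exact this.symm
            · intro u
              rw [LinearMap.add_apply, LinearMap.comp_apply]
              rcases lt_trichotomy u w with hu | rfl | hu
              · rw [partialSum_lof _ (show u ∈ Set.Iic w from hu.le)]
                have : DirectSum.component A W G w (lof A W G u (x u)) = 0 := by
                  rw [DirectSum.component.of, dif_neg hu.ne]
                rw [this, add_zero]
                by_cases huv : u ≤ v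
                · rw [partialSum_lof _ (show u ∈ Set.Iic v from huv), g_comp]
                · simp [hxv u hu (not_le.1 huv)]
              · rw [partialSum_lof _ (show u ∈ Set.Iic u from le_rfl), g_refl,
                  partialSum_lof_of_notMem _ (show u ∉ Set.Iic v from not_le.2 hv), map_zero,
                  zero_add, DirectSum.component.lof_self]
              · simp [hxw.1 u hu]
          refine Submodule.mem_iSup_of_mem ⟨v, hv⟩ ⟨fun u hu ↦ ?_, hv'⟩
          rcases lt_trichotomy u w with huw | rfl | huw
          · exact hxv u huw hu
          · exact hxw0
          · exact hxw.1 u huw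
        · intro hx0
          have hle : ⨆ v : Set.Iio w, (telescopeKer g v).comap
              (LinearMap.ker (partialSum Set.univ c)).subtype ≤
              LinearMap.ker (partialSum (Set.Iio w) h ∘ₗ Submodule.subtype _) := by
            refine iSup_le ?_
            rintro ⟨v, hv⟩ ⟨z, hz⟩ hzv
            change partialSum (Set.Iio w) h z = 0
            replace hzv : z ∈ telescopeKer g v := hzv
            rw [hh.partialSum_eq (isLowerSet_Iio w) hv z fun u _ hu ↦ hzv.1 u hu, hzv.2, map_zero]
          exact hle hx0
    · have hx0 : ∀ x ∈ telescopeKer g w, x = 0 := by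
        intro x hx
        ext u
        rcases lt_trichotomy u w with hu | rfl | hu
        · exact absurd ⟨u, hu⟩ hw
        · have := apply_eq_of_components (partialSum (Set.Iic u) (fun v hv ↦ g v u hv))
            (DirectSum.component A W G u) x ?_
          · rw [hx.2] at this
            exact this.symm
          · intro v
            rcases lt_trichotomy v u with hv | rfl | hv
            · exact absurd ⟨v, hv⟩ hw
            · rw [partialSum_lof _ (show v ∈ Set.Iic v from le_rfl), g_refl,
                  DirectSum.component.lof_self]
            · simp [hx.1 v hv]
        · exact hx.1 u hu
      refine ⟨PUnit, inferInstance, inferInstance, 0, LiftsAlong.of_subsingleton _,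
        fun y ↦ ⟨0, Subsingleton.elim _ _⟩, ?_⟩
      rintro ⟨⟨x, hx⟩, hxw⟩
      obtain rfl := hx0 x hxw
      exact ⟨fun _ ↦ Submodule.zero_mem _, fun _ ↦ rfl⟩
  · exact fun v w hvw x hx ↦ hmono hvw hx

end Telescope

section ExtVanishing

lemma exists_shortExact_of_enoughInjectives {C : Type u'} [Category.{v'} C] [Abelian C]
    [EnoughInjectives C] (N : C) :
    ∃ S : ShortComplex C, S.ShortExact ∧ S.X₁ = N ∧ Injective S.X₂ :=
  ⟨ShortComplex.mk (Injective.ι N) (cokernel.π (Injective.ι N)) (cokernel.condition _),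
    .mk' (ShortComplex.exact_of_g_is_cokernel _ (cokernelIsCokernel _)) inferInstance
      inferInstance, rfl, inferInstanceAs (Injective (Injective.under N))⟩

variable {C : Type u'} [Category.{v'} C] [Abelian C] [HasExt.{w} C] {S : ShortComplex C}

lemma CategoryTheory.ShortComplex.ShortExact.subsingleton_ext_X₃ (hS : S.ShortExact) (N : C) (i : ℕ)
    (h₁ : Subsingleton (Ext.{w} S.X₁ N i)) (h₂ : Subsingleton (Ext.{w} S.X₂ N (i + 1))) :
    Subsingleton (Ext.{w} S.X₃ N (i + 1)) := by
  refine subsingleton_of_forall_eq 0 fun x ↦ ?_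
  obtain ⟨y, rfl⟩ := Ext.contravariant_sequence_exact₃ hS N x (Subsingleton.elim _ _)
    (add_comm 1 i)
  rw [Subsingleton.elim y 0, Ext.comp_zero]

lemma CategoryTheory.ShortComplex.ShortExact.subsingleton_ext_X₁ (hS : S.ShortExact) (N : C) (i : ℕ)
    (h₂ : Subsingleton (Ext.{w} S.X₂ N i)) (h₃ : Subsingleton (Ext.{w} S.X₃ N (i + 1))) :
    Subsingleton (Ext.{w} S.X₁ N i) := by
  refine subsingleton_of_forall_eq 0 fun x ↦ ?_
  obtain ⟨y, rfl⟩ := Ext.contravariant_sequence_exact₁ hS N x (add_comm 1 i)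
    (Subsingleton.elim _ _)
  rw [Subsingleton.elim y 0, Ext.comp_zero]

lemma CategoryTheory.ShortComplex.ShortExact.subsingleton_ext_to_X₁ (hS : S.ShortExact) (X : C)
    (i : ℕ) (h₃ : Subsingleton (Ext.{w} X S.X₃ i)) (h₂ : Subsingleton (Ext.{w} X S.X₂ (i + 1))) :
    Subsingleton (Ext.{w} X S.X₁ (i + 1)) := by
  refine subsingleton_of_forall_eq 0 fun x ↦ ?_
  obtain ⟨y, rfl⟩ := Ext.covariant_sequence_exact₁ X hS x (Subsingleton.elim _ _) rfl
  rw [Subsingleton.elim y 0, Ext.zero_comp]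

lemma CategoryTheory.ShortComplex.ShortExact.subsingleton_ext_to_X₃ (hS : S.ShortExact) (X : C)
    (i : ℕ) (h₂ : Subsingleton (Ext.{w} X S.X₂ i)) (h₁ : Subsingleton (Ext.{w} X S.X₁ (i + 1))) :
    Subsingleton (Ext.{w} X S.X₃ i) := by
  refine subsingleton_of_forall_eq 0 fun x ↦ ?_
  obtain ⟨y, rfl⟩ := Ext.covariant_sequence_exact₃ X hS x rfl (Subsingleton.elim _ _)
  rw [Subsingleton.elim y 0, Ext.zero_comp]

lemma subsingleton_ext_of_iso {X Y : C} (e : X ≅ Y) (N : C) (i : ℕ)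
    (h : Subsingleton (Ext.{w} X N i)) : Subsingleton (Ext.{w} Y N i) := by
  refine subsingleton_of_forall_eq 0 fun x ↦ ?_
  have := Subsingleton.elim ((Ext.mk₀ e.hom).comp x (zero_add i)) 0
  rw [← Ext.mk₀_id_comp x, ← e.inv_hom_id, ← Ext.mk₀_comp_mk₀_assoc, this, Ext.comp_zero]

/-- If the vanishing of `Ext¹(X a, N)` for all `a` implies the vanishing of `Ext¹(Y, N)`, then the
same holds for `Extⁱ` with `i ≥ 1`. -/
lemma subsingleton_ext_of_subsingleton_ext_one [EnoughInjectives C] {ι : Type*} (X : ι → C) (Y : C)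
    (h : ∀ N, (∀ a, Subsingleton (Ext.{w} (X a) N 1)) → Subsingleton (Ext.{w} Y N 1)) (i : ℕ) :
    ∀ N, (∀ a, Subsingleton (Ext.{w} (X a) N (i + 1))) → Subsingleton (Ext.{w} Y N (i + 1)) := by
  induction i with
  | zero => exact h
  | succ i ih =>
    intro N hN
    obtain ⟨S, hS, rfl, hI⟩ := exists_shortExact_of_enoughInjectives N
    exact hS.subsingleton_ext_to_X₁ _ _
      (ih _ fun a ↦ hS.subsingleton_ext_to_X₃ _ _ (Ext.subsingleton_of_injective _ _ _) (hN a))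
      (Ext.subsingleton_of_injective _ _ _)

variable {A : Type u} [Ring A] [HasExt.{w} (ModuleCat.{u} A)]

lemma liftsAlong_iff_subsingleton_ext {S : ShortComplex (ModuleCat.{u} A)} (hS : S.ShortExact)
    [Injective S.X₂] (X : ModuleCat.{u} A) :
    LiftsAlong S.g.hom X ↔ Subsingleton (Ext.{w} X S.X₁ 1) := by
  constructor
  · intro h
    refine subsingleton_of_forall_eq 0 fun x ↦ ?_
    obtain ⟨y, rfl⟩ := Ext.covariant_sequence_exact₁ X hS x (Ext.eq_zero_of_injective _)
      (zero_add 1)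
    obtain ⟨f, rfl⟩ := Ext.mk₀_bijective _ _ |>.2 y
    obtain ⟨g, hg⟩ := h f.hom
    obtain rfl : ModuleCat.ofHom g ≫ S.g = f := by
      ext : 1
      exact hg
    rw [← Ext.mk₀_comp_mk₀, Ext.comp_assoc_of_second_deg_zero, hS.comp_extClass, Ext.comp_zero]
  · intro h f
    obtain ⟨y, hy⟩ := Ext.covariant_sequence_exact₃ X hS (Ext.mk₀ (ModuleCat.ofHom f))
      (zero_add 1) (Subsingleton.elim _ _)
    obtain ⟨g, rfl⟩ := Ext.mk₀_bijective _ _ |>.2 y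
    rw [Ext.mk₀_comp_mk₀] at hy
    refine ⟨g.hom, ?_⟩
    have := (Ext.mk₀_bijective _ _).1 hy
    exact congr_arg ModuleCat.Hom.hom this

/-- The vanishing of `Ext¹` propagates along any implication which holds for the lifting property
along all epimorphisms from injective modules. -/
lemma subsingleton_ext_of_liftsAlong {ι : Type*} (X : ι → ModuleCat.{u} A) (Y : ModuleCat.{u} A)
    (h : ∀ (I C : ModuleCat.{u} A) (p : I →ₗ[A] C), Module.Injective A I →
      (∀ a, LiftsAlong p (X a)) → LiftsAlong p Y) (N : ModuleCat.{u} A) (i : ℕ)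
    (hN : ∀ a, Subsingleton (Ext.{w} (X a) N (i + 1))) : Subsingleton (Ext.{w} Y N (i + 1)) := by
  refine subsingleton_ext_of_subsingleton_ext_one X Y (fun N hN ↦ ?_) i N hN
  obtain ⟨S, hS, rfl, hI⟩ := exists_shortExact_of_enoughInjectives N
  rw [← liftsAlong_iff_subsingleton_ext hS]
  exact h _ _ _ ((Module.injective_iff_injective_object _ _).2 hI)
    fun a ↦ (liftsAlong_iff_subsingleton_ext hS _).2 (hN a)

open DirectSum in
/-- Let `F` be the colimit of a system `(G, g)` indexed by a well-ordered set. If `Extⁱ(-, N)`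
vanishes for `i ≥ 1` on the modules `G w` and on the colimits of the initial segments of the
system, then `Extⁱ(F, N) = 0` for `i ≥ 2`. -/
lemma subsingleton_ext_of_wellOrdered_colimit {W : Type u} [LinearOrder W] [WellFoundedLT W]
    [Nonempty W] {G : W → ModuleCat.{u} A} {g : ∀ v w, v ≤ w → G v →ₗ[A] G w}
    (g_comp : ∀ u v w (huv : u ≤ v) (hvw : v ≤ w) x,
      g v w hvw (g u v huv x) = g u w (huv.trans hvw) x)
    (g_refl : ∀ v x, g v v le_rfl x = x)
    {F : ModuleCat.{u} A} (c : ∀ v ∈ Set.univ, G v →ₗ[A] F) (hc : IsMonoCocone g Set.univ c)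
    (hcsurj : ∀ y, ∃ v, ∃ hv : v ∈ Set.univ, ∃ x, c v hv x = y) (N : ModuleCat.{u} A)
    (hG : ∀ w i, Subsingleton (Ext.{w} (G w) N (i + 1)))
    (hH : ∀ w, (Set.Iio w).Nonempty → ∃ (H : ModuleCat.{u} A)
      (h : ∀ v ∈ Set.Iio w, G v →ₗ[A] H), IsMonoCocone g (Set.Iio w) h ∧
        (∀ y, ∃ v, ∃ hv : v ∈ Set.Iio w, ∃ x, h v hv x = y) ∧
        ∀ i, Subsingleton (Ext.{w} H N (i + 1))) (i : ℕ) :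
    Subsingleton (Ext.{w} F N (i + 2)) := by
  choose H h hh hsurj hHN using hH
  let S : ShortComplex (ModuleCat.{u} A) :=
    ShortComplex.mk (ModuleCat.ofHom (LinearMap.ker (partialSum Set.univ c)).subtype)
      (ModuleCat.ofHom (partialSum Set.univ c)) (by ext x; exact x.2)
  have hS : S.ShortExact := by
    refine .mk' ?_ ?_ ?_
    · rw [ShortComplex.moduleCat_exact_iff]
      exact fun x hx ↦ ⟨⟨x, hx⟩, rfl⟩
    · rw [ModuleCat.mono_iff_injective]
      exact Subtype.val_injective
    · rw [ModuleCat.epi_iff_surjective]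
      intro y
      obtain ⟨v, hv, x, rfl⟩ := hcsurj y
      exact ⟨lof A W (fun w ↦ G w) v x, partialSum_lof _ hv _⟩
  refine hS.subsingleton_ext_X₃ N (i + 1) ?_ ?_
  · refine subsingleton_ext_of_liftsAlong
      (fun a : {w : W // (Set.Iio w).Nonempty} ↦ H a.1 a.2) _ (fun I C p _ hp ↦ ?_) N i
      fun a ↦ hHN a.1 a.2 i
    exact LiftsAlong.ker_partialSum g_comp g_refl c hc fun w hw ↦
      ⟨H w hw, inferInstance, inferInstance, h w hw, hh w hw, hsurj w hw, hp ⟨w, hw⟩⟩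
  · exact subsingleton_ext_of_liftsAlong G _ (fun I C p _ hp ↦ LiftsAlong.directSum hp) N (i + 1)
      fun a ↦ hG a _

end ExtVanishing

section Restriction

variable {A : Type u} [Ring A] {P : Type u} [Preorder P] (D : P ⥤ ModuleCat.{u} A)

/-- The restriction of a diagram `D` on `P` to a subset `T` of `P`. -/
def restrictDiagram (T : Set P) : T ⥤ ModuleCat.{u} A :=
  (show Monotone ((↑) : T → P) from fun _ _ h ↦ h).functor ⋙ D

/-- The colimit of the restriction of a diagram to a subset. -/
noncomputable def restrictColimit (T : Set P) : ModuleCat.{u} A :=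
  colimit (restrictDiagram D T)

/-- The structure maps of `restrictColimit`. -/
noncomputable def restrictColimit.ι {T : Set P} {E : P} (hE : E ∈ T) :
    D.obj E ⟶ restrictColimit D T :=
  colimit.ι (restrictDiagram D T) ⟨E, hE⟩

variable {D}

lemma restrictColimit.w {T : Set P} {E E' : P} (hE : E ∈ T) (hE' : E' ∈ T) (h : E ≤ E') :
    D.map (homOfLE h) ≫ ι D hE' = ι D hE :=
  colimit.w (restrictDiagram D T) (homOfLE (show (⟨E, hE⟩ : T) ≤ ⟨E', hE'⟩ from h))

lemma restrictColimit.hom_ext {T : Set P} {X : ModuleCat.{u} A} {f g : restrictColimit D T ⟶ X}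
    (h : ∀ E (hE : E ∈ T), ι D hE ≫ f = ι D hE ≫ g) : f = g :=
  colimit.hom_ext fun E ↦ h E.1 E.2

variable (D) in
/-- The canonical map between the colimits over `S ⊆ T`. -/
noncomputable def restrictColimit.map {S T : Set P} (h : S ⊆ T) :
    restrictColimit D S ⟶ restrictColimit D T :=
  colimit.desc (restrictDiagram D S)
    { pt := restrictColimit D T
      ι :=
        { app E := ι D (h E.2)
          naturality E E' f := (restrictColimit.w (h E.2) (h E'.2) (leOfHom f)).trans
            (Category.comp_id (restrictColimit.ι D (h E.2))).symm } }

lemma restrictColimit.ι_map {S T : Set P} (h : S ⊆ T) {E : P} (hE : E ∈ S) :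
    ι D hE ≫ map D h = ι D (h hE) :=
  colimit.ι_desc _ (⟨E, hE⟩ : S)

lemma restrictColimit.map_comp {S T U : Set P} (h : S ⊆ T) (h' : T ⊆ U) :
    map D h ≫ map D h' = map D (h.trans h') :=
  hom_ext fun E hE ↦ by rw [← Category.assoc, ι_map, ι_map, ι_map]

lemma restrictColimit.map_refl (S : Set P) : map D (subset_refl S) = 𝟙 _ :=
  hom_ext fun E hE ↦ by rw [ι_map, Category.comp_id]

lemma isFiltered_of_directedOn {T : Set P} (hT : DirectedOn (· ≤ ·) T) (hT' : T.Nonempty) :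
    IsFiltered T := by
  have := hT'.to_subtype
  have : IsDirectedOrder T := directedOn_iff_isDirectedOrder.1 hT
  infer_instance

lemma restrictColimit.exists_rep {T : Set P} (y : restrictColimit D T)
    (hT : DirectedOn (· ≤ ·) T) (hT' : T.Nonempty) :
    ∃ E, ∃ hE : E ∈ T, ∃ x, ι D hE x = y := by
  have := isFiltered_of_directedOn hT hT'
  obtain ⟨E, x, h⟩ := Concrete.colimit_exists_rep (restrictDiagram D T) y
  exact ⟨E.1, E.2, x, h⟩

lemma restrictColimit.exists_map_eq_zero {T : Set P} (hT : DirectedOn (· ≤ ·) T) {E : P}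
    (hE : E ∈ T) (x : D.obj E) (hx : ι D hE x = 0) :
    ∃ E' ∈ T, ∃ h : E ≤ E', D.map (homOfLE h) x = 0 := by
  have := isFiltered_of_directedOn hT ⟨E, hE⟩
  obtain ⟨E', f, f', h⟩ := Concrete.colimit_exists_of_rep_eq (restrictDiagram D T)
    (i := ⟨E, hE⟩) (j := ⟨E, hE⟩) x 0 (hx.trans (map_zero _).symm)
  exact ⟨E'.1, E'.2, leOfHom f, h.trans (map_zero _)⟩

/-- The colimit over a chain union of directed sets is the directed union of the colimits. -/
lemma restrictColimit.isMonoCocone {W : Type u} [LinearOrder W] {𝒮 : W → Set P} (hmono : Monotone 𝒮)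
    (hdir : ∀ v, DirectedOn (· ≤ ·) (𝒮 v)) (hne : ∀ v, (𝒮 v).Nonempty) {s : Set W} {T : Set P}
    (hT : DirectedOn (· ≤ ·) T) (hle : ∀ v ∈ s, 𝒮 v ⊆ T) (hcover : ∀ E ∈ T, ∃ v ∈ s, E ∈ 𝒮 v) :
    IsMonoCocone (G := fun v ↦ restrictColimit D (𝒮 v)) (fun _ _ h ↦ (map D (hmono h)).hom) s
      (F := restrictColimit D T) fun v hv ↦ (map D (hle v hv)).hom where
  comp v w hv hw h x := by
    have := map_comp (D := D) (hmono h) (hle w hw)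
    exact congr($this x)
  exists_eq_zero v hv y hy := by
    obtain ⟨E, hE, x, rfl⟩ := exists_rep y (hdir v) (hne v)
    have h1 : ι D (hle v hv hE) x = 0 := by
      rw [← ι_map (hle v hv) hE]
      exact hy
    obtain ⟨E', hE', hle', h2⟩ := exists_map_eq_zero hT _ x h1
    obtain ⟨w, hw, hw'⟩ := hcover E' hE'
    obtain ⟨u, hu, hvu, hwu⟩ : ∃ u ∈ s, v ≤ u ∧ w ≤ u := by
      rcases le_total v w with h | h
      exacts [⟨w, hw, h, le_rfl⟩, ⟨v, hv, le_rfl, h⟩]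
    refine ⟨u, hu, hvu, ?_⟩
    have h3 : ι D hE ≫ map D (hmono hvu) = D.map (homOfLE hle') ≫ ι D (hmono hwu hw') := by
      rw [ι_map, restrictColimit.w]
    have h4 := congr($h3 x)
    refine h4.trans ?_
    rw [ModuleCat.comp_apply, h2, map_zero]

lemma restrictColimit.exists_map_eq {W : Type u} {𝒮 : W → Set P} {s : Set W} {T : Set P}
    (hT : DirectedOn (· ≤ ·) T) (hT' : T.Nonempty) (hle : ∀ v ∈ s, 𝒮 v ⊆ T)
    (hcover : ∀ E ∈ T, ∃ v ∈ s, E ∈ 𝒮 v) (y : restrictColimit D T) :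
    ∃ v, ∃ hv : v ∈ s, ∃ x, (map D (hle v hv)).hom x = y := by
  obtain ⟨E, hE, x, rfl⟩ := exists_rep y hT hT'
  obtain ⟨v, hv, hEv⟩ := hcover E hE
  exact ⟨v, hv, ι D hEv x, congr($(ι_map (D := D) (hle v hv) hEv) x)⟩

variable [HasExt.{w} (ModuleCat.{u} A)]

/-- A well-ordered union of directed sets, in terms of the colimits of a diagram over them. -/
lemma subsingleton_ext_restrictColimit {W : Type u} [LinearOrder W] [WellFoundedLT W] [Nonempty W]
    {𝒮 : W → Set P} (hmono : Monotone 𝒮) (hdir : ∀ v, DirectedOn (· ≤ ·) (𝒮 v))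
    (hne : ∀ v, (𝒮 v).Nonempty) {T : Set P} (hT : T = ⋃ v, 𝒮 v) (N : ModuleCat.{u} A)
    (hG : ∀ v i, Subsingleton (Ext.{w} (restrictColimit D (𝒮 v)) N (i + 1)))
    (hH : ∀ v, (Set.Iio v).Nonempty → ∀ i,
      Subsingleton (Ext.{w} (restrictColimit D (⋃ u ∈ Set.Iio v, 𝒮 u)) N (i + 1))) (i : ℕ) :
    Subsingleton (Ext.{w} (restrictColimit D T) N (i + 2)) := by
  have hdirU (s : Set W) : DirectedOn (· ≤ ·) (⋃ u ∈ s, 𝒮 u) := by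
    intro E hE E' hE'
    simp only [Set.mem_iUnion, exists_prop] at hE hE'
    obtain ⟨v, hv, hE⟩ := hE
    obtain ⟨v', hv', hE'⟩ := hE'
    obtain ⟨u, hu, hvu, hvu'⟩ : ∃ u ∈ s, v ≤ u ∧ v' ≤ u := by
      rcases le_total v v' with h | h
      exacts [⟨v', hv', h, le_rfl⟩, ⟨v, hv, le_rfl, h⟩]
    obtain ⟨E'', h, h'⟩ := hdir u E (hmono hvu hE) E' (hmono hvu' hE')
    exact ⟨E'', Set.mem_biUnion hu h, h'⟩
  have hneU (s : Set W) (hs : s.Nonempty) : (⋃ u ∈ s, 𝒮 u).Nonempty := by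
    obtain ⟨v, hv⟩ := hs
    obtain ⟨E, hE⟩ := hne v
    exact ⟨E, Set.mem_biUnion hv hE⟩
  have hle (s : Set W) (v) (hv : v ∈ s) : 𝒮 v ⊆ ⋃ u ∈ s, 𝒮 u := Set.subset_biUnion_of_mem hv
  have hcover (s : Set W) (E) (hE : E ∈ ⋃ u ∈ s, 𝒮 u) : ∃ v ∈ s, E ∈ 𝒮 v := by
    simpa using hE
  rw [← Set.biUnion_univ] at hT
  subst hT
  refine subsingleton_ext_of_wellOrdered_colimit
    (G := fun v ↦ restrictColimit D (𝒮 v)) (g := fun v w h ↦ (restrictColimit.map D (hmono h)).hom)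
    (fun u v w huv hvw x ↦ congr($(restrictColimit.map_comp (D := D) (hmono huv) (hmono hvw)) x))
    (fun v x ↦ congr($(restrictColimit.map_refl (D := D) (𝒮 v)) x)) _
    (restrictColimit.isMonoCocone hmono hdir hne (hdirU _) (hle _) (hcover _))
    (restrictColimit.exists_map_eq (hdirU _) (hneU _ Set.univ_nonempty) (hle _) (hcover _)) N hG
    (fun v hv ↦ ⟨_, _, restrictColimit.isMonoCocone hmono hdir hne (hdirU _) (hle _) (hcover _),
      restrictColimit.exists_map_eq (hdirU _) (hneU _ hv) (hle _) (hcover _), hH v hv⟩) i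

end Restriction

section FinsetDiagram

variable {A : Type u} [Ring A] [HasExt.{w} (ModuleCat.{u} A)]

lemma directedOn_finset_subset {α : Type*} (T : Set α) :
    DirectedOn (· ≤ ·) {E : Finset α | (E : Set α) ⊆ T} := by
  classical
  intro E hE E' hE'
  refine ⟨E ∪ E', ?_, Finset.subset_union_left, Finset.subset_union_right⟩
  rw [Set.mem_ofPred_eq, Finset.coe_union]
  exact Set.union_subset hE hE'

lemma nonempty_finset_subset {α : Type*} (T : Set α) :
    {E : Finset α | (E : Set α) ⊆ T}.Nonempty :=
  ⟨∅, by simp⟩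

lemma finset_subset_image_eq_iUnion {α : Type*} {T : Set α} [LinearOrder T] {s : Set T}
    (hs : s.Nonempty) (hs' : IsLowerSet s) :
    {E : Finset α | (E : Set α) ⊆ Subtype.val '' s} =
      ⋃ v ∈ s, {E : Finset α | (E : Set α) ⊆ Subtype.val '' Set.Iic v} := by
  ext E
  simp only [Set.mem_ofPred_eq, Set.mem_iUnion, exists_prop]
  constructor
  · intro hE
    refine DirectedOn.exists_mem_subset_of_finset_subset_biUnion (s := E) hs ?_ ?_
    · intro v hv v' hv'
      rcases le_total v v' with h | h
      · exact ⟨v', hv', Set.image_mono (Set.Iic_subset_Iic.2 h), subset_rfl⟩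
      · exact ⟨v, hv, subset_rfl, Set.image_mono (Set.Iic_subset_Iic.2 h)⟩
    · intro x hx
      obtain ⟨v, hv, rfl⟩ := hE hx
      exact Set.mem_biUnion hv ⟨v, le_rfl, rfl⟩
  · rintro ⟨v, hv, hE⟩
    exact hE.trans (Set.image_mono fun u hu ↦ hs' hu hv)

/-- The vanishing of `Extⁱ(-, N)` for `i ≥ 1` passes to the colimit of a diagram indexed by finite
sets, as soon as the vanishing for `i ≥ 2` implies the vanishing for `i = 1` on all the colimits
of the diagram over directed sets of finite sets. -/
lemma subsingleton_ext_restrictColimit_finset {α : Type u} (D : Finset α ⥤ ModuleCat.{u} A)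
    (N : ModuleCat.{u} A) (hD : ∀ E i, Subsingleton (Ext.{w} (D.obj E) N (i + 1)))
    (hstep : ∀ T : Set (Finset α), DirectedOn (· ≤ ·) T → T.Nonempty →
      (∀ i, Subsingleton (Ext.{w} (restrictColimit D T) N (i + 2))) →
      Subsingleton (Ext.{w} (restrictColimit D T) N 1)) (T : Set α) (i : ℕ) :
    Subsingleton (Ext.{w} (restrictColimit D {E : Finset α | (E : Set α) ⊆ T}) N (i + 1)) := by
  induction hκ : Cardinal.mk T using WellFoundedLT.induction generalizing T i with
  | ind κ ih =>
  subst hκ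
  by_cases hfin : T.Finite
  · let t : {E : Finset α | (E : Set α) ⊆ T} := ⟨hfin.toFinset, by simp⟩
    have ht : IsTerminal t := by
      refine IsTerminal.ofUniqueHom (fun E ↦ homOfLE ?_) fun _ _ ↦ Subsingleton.elim _ _
      change (E : Finset α) ⊆ hfin.toFinset
      rw [Set.Finite.subset_toFinset]
      exact E.2
    have := isIso_ι_of_isTerminal ht (restrictDiagram D {E : Finset α | (E : Set α) ⊆ T})
    exact subsingleton_ext_of_iso
      (asIso (colimit.ι (restrictDiagram D {E : Finset α | (E : Set α) ⊆ T}) t)) N (i + 1) (hD _ i)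
  · have hinf : Cardinal.aleph0 ≤ Cardinal.mk T :=
      Cardinal.aleph0_le_mk_iff.2 (Set.infinite_coe_iff.2 hfin)
    have hTne : Nonempty T := (Set.infinite_coe_iff.2 hfin).nonempty
    have key : ∀ i, Subsingleton
        (Ext.{w} (restrictColimit D {E : Finset α | (E : Set α) ⊆ T}) N (i + 2)) := by
      obtain ⟨_, _, hord⟩ := Cardinal.exists_ord_eq_type_lt T
      refine subsingleton_ext_restrictColimit
        (𝒮 := fun v : T ↦ {E : Finset α | (E : Set α) ⊆ Subtype.val '' Set.Iic v})
        (fun v w h E hE ↦ hE.trans (Set.image_mono (Set.Iic_subset_Iic.2 h)))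
        (fun v ↦ directedOn_finset_subset _) (fun v ↦ nonempty_finset_subset _) ?_ N ?_ ?_
      · have := finset_subset_image_eq_iUnion (T := T) Set.univ_nonempty isLowerSet_univ
        rw [Set.biUnion_univ] at this
        rw [← this, Subtype.coe_image_univ]
      · exact fun v i ↦ ih _ (Cardinal.mk_image_le.trans_lt (Cardinal.mk_Iic_lt v hord hinf)) _ i rfl
      · intro v hv i
        rw [← finset_subset_image_eq_iUnion hv (isLowerSet_Iio v)]
        exact ih _ (Cardinal.mk_image_le.trans_lt (Cardinal.mk_Iio_lt v hord)) _ i rfl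
    cases i with
    | zero => exact hstep _ (directedOn_finset_subset T) (nonempty_finset_subset T) key
    | succ i => exact key i

/-- A directed poset receives a cofinal monotone map from the poset of its finite subsets. -/
lemma exists_monotone_finset (α : Type u) [PartialOrder α] [IsDirectedOrder α] [Nonempty α] :
    ∃ σ : Finset α → α, Monotone σ ∧ ∀ x, x ≤ σ {x} := by
  classical
  choose ub hub using fun s : Finset α ↦ s.exists_le
  let σ : Finset α → α := Finset.strongInduction fun E ih ↦
    ub (E ∪ E.ssubsets.attach.image fun E' ↦ ih E'.1 (Finset.mem_ssubsets.1 E'.2))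
  have hσ (E : Finset α) : σ E = ub (E ∪ E.ssubsets.attach.image fun E' ↦ σ E'.1) :=
    Finset.strongInduction_eq _ _
  refine ⟨σ, fun E E' h ↦ ?_, fun x ↦ ?_⟩
  · rcases eq_or_ssubset_of_subset h with rfl | h
    · exact le_rfl
    · rw [hσ E']
      refine hub _ _ (Finset.mem_union_right _ (Finset.mem_image.2
        ⟨⟨E, Finset.mem_ssubsets.2 h⟩, Finset.mem_attach _ _, rfl⟩))
  · rw [hσ]
    exact hub _ _ (Finset.mem_union_left _ (Finset.mem_singleton_self x))

/-- A small filtered category receives a final functor from a poset of finite subsets. -/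
lemma exists_final_finset (J : Type u) [SmallCategory J] [IsFiltered J] :
    ∃ (α : Type u) (F : Finset α ⥤ J), F.Final := by
  classical
  obtain ⟨α, _, _, _, F, hF⟩ := IsFiltered.exists_directed J
  obtain ⟨σ, hσ, hσ'⟩ := exists_monotone_finset α
  have : hσ.functor.Final := by
    refine Functor.final_of_exists_of_isFiltered _ (fun x ↦ ⟨{x}, ⟨homOfLE (hσ' x)⟩⟩) ?_
    exact fun _ _ ↦ ⟨_, 𝟙 _, Subsingleton.elim _ _⟩
  exact ⟨α, hσ.functor ⋙ F, inferInstance⟩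

/-- The colimit over all of `P` is the colimit of the whole diagram. -/
noncomputable def restrictColimitUnivIso {P : Type u} [Preorder P] (D : P ⥤ ModuleCat.{u} A) :
    restrictColimit D Set.univ ≅ colimit D :=
  Functor.Final.colimitIso (OrderIso.Set.univ (α := P)).equivalence.functor D

end FinsetDiagram

section AInfty

variable {R : Type u} [Ring R] [HasExt.{w} (ModuleCat.{u} Rᵐᵒᵖ)]

lemma MemAInfty.of_colimit {J : Type u} [SmallCategory J] [IsFiltered J]
    (D : J ⥤ ModuleCat.{u} Rᵐᵒᵖ) (hD : ∀ j, MemPModR R (D.obj j)) : MemAInfty R (colimit D) :=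
  ⟨J, inferInstance, inferInstance, D, colimit.cocone D, hD, ⟨colimit.isColimit D⟩, ⟨Iso.refl _⟩⟩

lemma MemPModR.memAInfty {F : ModuleCat.{u} Rᵐᵒᵖ} (hF : MemPModR R F) : MemAInfty R F := by
  let D : Discrete PUnit.{u + 1} ⥤ ModuleCat.{u} Rᵐᵒᵖ := (Functor.const _).obj F
  have : IsFiltered (Discrete PUnit.{u + 1}) := inferInstance
  have ht : IsTerminal (⟨⟨⟩⟩ : Discrete PUnit.{u + 1}) :=
    IsTerminal.ofUniqueHom (fun _ ↦ ⟨⟨Subsingleton.elim _ _⟩⟩) fun _ _ ↦ Subsingleton.elim _ _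
  exact ⟨Discrete PUnit.{u + 1}, inferInstance, inferInstance, D, coconeOfDiagramTerminal ht D,
    fun _ ↦ hF, ⟨colimitOfDiagramTerminal ht D⟩, ⟨Iso.refl _⟩⟩

lemma MemAInfty.exists_finset_diagram {F : ModuleCat.{u} Rᵐᵒᵖ} (hF : MemAInfty R F) :
    ∃ (α : Type u) (D : Finset α ⥤ ModuleCat.{u} Rᵐᵒᵖ),
      (∀ E, MemPModR R (D.obj E)) ∧ Nonempty (colimit D ≅ F) := by
  obtain ⟨J, _, _, D, c, hD, ⟨hc⟩, ⟨e⟩⟩ := hF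
  obtain ⟨α, G, _⟩ := exists_final_finset J
  exact ⟨α, G ⋙ D, fun E ↦ hD _,
    ⟨Functor.Final.colimitIso G D ≪≫ (colimit.isColimit D).coconePointUniqueUpToIso hc ≪≫ e⟩⟩

/-- Vanishing of `Extⁱ(-, N)` for `i ≥ 1` passes from `P(mod-R)` to `𝒜^∞`, as soon as on `𝒜^∞` the
vanishing for `i ≥ 2` implies the vanishing for `i = 1`. -/
lemma MemAInfty.subsingleton_ext (N : ModuleCat.{u} Rᵐᵒᵖ)
    (hP : ∀ F, MemPModR R F → ∀ i, Subsingleton (Ext.{w} F N (i + 1)))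
    (hstep : ∀ F, MemAInfty R F → (∀ i, Subsingleton (Ext.{w} F N (i + 2))) →
      Subsingleton (Ext.{w} F N 1)) {F : ModuleCat.{u} Rᵐᵒᵖ} (hF : MemAInfty R F) (i : ℕ) :
    Subsingleton (Ext.{w} F N (i + 1)) := by
  obtain ⟨α, D, hD, ⟨e⟩⟩ := hF.exists_finset_diagram
  refine subsingleton_ext_of_iso (restrictColimitUnivIso D ≪≫ e) N (i + 1) ?_
  have h := subsingleton_ext_restrictColimit_finset D N (fun E ↦ hP _ (hD E)) ?_ Set.univ i
  · have huniv : {E : Finset α | (E : Set α) ⊆ Set.univ} = Set.univ := by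
      ext E
      simp
    rwa [huniv] at h
  · intro T hT hT'
    have := isFiltered_of_directedOn hT hT'
    exact hstep _ (.of_colimit (restrictDiagram D T) fun E ↦ hD _)

end AInfty

section Syzygy

variable {C : Type u'} [Category.{v'} C] [Abelian C]

/-- A projective resolution from an exact complex of projective objects with an augmentation. -/
noncomputable def CategoryTheory.ProjectiveResolution.ofExact (K : ChainComplex C ℕ)
    [∀ n, Projective (K.X n)] {Z : C} (f : K.X 0 ⟶ Z) (w : K.d 1 0 ≫ f = 0) [Epi f]
    (h₀ : (ShortComplex.mk _ _ w).Exact) (h : ∀ n, K.ExactAt (n + 1)) :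
    ProjectiveResolution Z where
  complex := K
  π := (ChainComplex.toSingle₀Equiv _ _).symm ⟨f, w⟩
  quasiIso := ⟨fun n ↦ by
    cases n with
    | zero =>
      rw [ChainComplex.quasiIsoAt₀_iff, ShortComplex.quasiIso_iff_of_zeros']
      · refine (ShortComplex.exact_and_epi_g_iff_of_iso ?_).2
          (show (ShortComplex.mk _ _ w).Exact ∧ Epi (ShortComplex.mk _ _ w).g from
            ⟨h₀, inferInstanceAs (Epi f)⟩)
        exact ShortComplex.isoMk (Iso.refl _) (Iso.refl _) (Iso.refl _)
          ((Category.id_comp _).trans (Category.comp_id _).symm)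
          ((Category.id_comp _).trans ((ChainComplex.toSingle₀Equiv_symm_apply_f_zero f w).symm.trans
            (Category.comp_id _).symm))
      · exact K.shape 0 0 (by simp)
      · rfl
      · rfl
    | succ n =>
      rw [quasiIsoAt_iff_exactAt']
      · exact h n
      · exact ChainComplex.exactAt_succ_single_obj _ _⟩

/-- The truncation of a projective resolution, as a resolution of the first syzygy. -/
noncomputable def CategoryTheory.ProjectiveResolution.syzygy {X : C} (P : ProjectiveResolution X) :
    ProjectiveResolution (kernel (P.π.f 0)) :=
  have : ∀ n, Projective ((ChainComplex.truncate.obj P.complex).X n) :=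
    fun n ↦ P.projective (n + 1)
  let f : (ChainComplex.truncate.obj P.complex).X 0 ⟶ kernel (P.π.f 0) :=
    kernel.lift (P.π.f 0) (P.complex.d 1 0) P.complex_d_comp_π_f_zero
  have : Epi f := P.exact₀.epi_kernelLift
  have w : P.complex.d 2 1 ≫
      kernel.lift (P.π.f 0) (P.complex.d 1 0) P.complex_d_comp_π_f_zero = 0 := by
    rw [← cancel_mono (kernel.ι (P.π.f 0)), Category.assoc, kernel.lift_ι, P.complex.d_comp_d,
      zero_comp]
  .ofExact (ChainComplex.truncate.obj P.complex) f w
    (by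
      let φ : ShortComplex.mk _ _ w ⟶ ShortComplex.mk _ _ (P.complex.d_comp_d 2 1 0) :=
        { τ₁ := 𝟙 _
          τ₂ := 𝟙 _
          τ₃ := kernel.ι (P.π.f 0)
          comm₁₂ := (Category.id_comp _).trans (Category.comp_id _).symm
          comm₂₃ := (Category.id_comp _).trans (kernel.lift_ι _ _ _).symm }
      have : Epi φ.τ₁ := inferInstanceAs (Epi (𝟙 _))
      have : IsIso φ.τ₂ := inferInstanceAs (IsIso (𝟙 _))
      have : Mono φ.τ₃ := inferInstanceAs (Mono (kernel.ι _))
      exact (ShortComplex.exact_iff_of_epi_of_isIso_of_mono φ).2 (P.exact_succ 0))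
    fun n ↦ (HomologicalComplex.exactAt_iff' _ (n + 2) (n + 1) n (by simp) (by simp)).2
      (P.exact_succ (n + 1))

lemma CategoryTheory.ProjectiveResolution.shortExact_syzygy {X : C} (P : ProjectiveResolution X) :
    (ShortComplex.mk (kernel.ι (P.π.f 0)) (P.π.f 0) (kernel.condition _)).ShortExact :=
  .mk' (ShortComplex.exact_of_f_is_kernel _ (kernelIsKernel _)) inferInstance inferInstance

end Syzygy

section Orthogonal

variable {R : Type u} [Ring R] [HasExt.{w} (ModuleCat.{u} Rᵐᵒᵖ)]

lemma MemPModR.exists_syzygy {F : ModuleCat.{u} Rᵐᵒᵖ} (hF : MemPModR R F) :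
    ∃ S : ShortComplex (ModuleCat.{u} Rᵐᵒᵖ), S.ShortExact ∧ MemPModR R S.X₁ ∧
      Projective S.X₂ ∧ S.X₃ = F := by
  obtain ⟨⟨n, hn⟩, P, hP⟩ := hF
  refine ⟨_, P.shortExact_syzygy, ⟨⟨n, fun N i hi ↦ ?_⟩, P.syzygy, fun k ↦ hP (k + 1)⟩,
    P.projective 0, rfl⟩
  have := P.projective 0
  obtain ⟨i, rfl⟩ := Nat.exists_eq_succ_of_ne_zero (Nat.ne_zero_of_lt hi)
  exact P.shortExact_syzygy.subsingleton_ext_X₁ N (i + 1)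
    (Ext.subsingleton_of_projective (P.complex.X 0) N i) (hn N _ (by lia))

/-- The class `ℬ_∞` is orthogonal to `P(mod-R)` with respect to all higher `Ext`. -/
lemma MemPModR.subsingleton_ext {B : ModuleCat.{u} Rᵐᵒᵖ}
    (hB : ∀ F, MemAInfty R F → Subsingleton (Ext.{w} F B 1)) (i : ℕ) :
    ∀ F, MemPModR R F → Subsingleton (Ext.{w} F B (i + 1)) := by
  induction i with
  | zero => exact fun F hF ↦ hB F hF.memAInfty
  | succ i ih =>
    intro F hF
    obtain ⟨S, hS, h₁, h₂, rfl⟩ := hF.exists_syzygy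
    exact hS.subsingleton_ext_X₃ B (i + 1) (ih _ h₁) (Ext.subsingleton_of_projective _ _ _)

end Orthogonal

/-- a `ℬ_∞`-periodic module belongs to `ℬ_∞`.
Right `R`-modules are modules over `Rᵐᵒᵖ`. -/
theorem stmt9 (R : Type u) [Ring R] [HasExt.{w} (ModuleCat.{u} Rᵐᵒᵖ)]
    (M B : ModuleCat.{u} Rᵐᵒᵖ)
    -- `B ∈ ℬ_∞`:
    (hB : ∀ F : ModuleCat.{u} Rᵐᵒᵖ, MemAInfty R F → Subsingleton (Abelian.Ext.{w} F B 1))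
    -- `0 → M → B → M → 0` is exact:
    (hper : IsShortExactSeq M B M) :
    -- `M ∈ ℬ_∞`:
    ∀ F : ModuleCat.{u} Rᵐᵒᵖ, MemAInfty R F → Subsingleton (Abelian.Ext.{w} F M 1) := by
  obtain ⟨f, g, w, hS⟩ := hper
  refine fun F hF ↦ MemAInfty.subsingleton_ext M (fun F hF i ↦ ?_) (fun F hF h ↦ ?_) hF 0
  · have descend (k : ℕ) : ∀ i, Subsingleton (Ext.{w} F M (i + 1 + k)) →
        Subsingleton (Ext.{w} F M (i + 1)) := by
      induction k with
      | zero => exact fun i h ↦ h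
      | succ k ih =>
        intro i h
        refine hS.subsingleton_ext_to_X₃ F (i + 1) (MemPModR.subsingleton_ext hB i F hF)
          (ih (i + 1) ?_)
        rwa [show i + 1 + 1 + k = i + 1 + (k + 1) by lia]
    obtain ⟨n, hn⟩ := hF.1
    exact descend n i (hn M _ (by lia))
  · exact hS.subsingleton_ext_to_X₃ F 1 (hB F hF) (h 0)
end

section
/- Let R be a ring and let Y be an acyclic unbounded cochain complex of injective right R-modules. Then every cycle module Z^n(Y) of Y belongs to ℬ_∞; that is, Ext^1_R(F, Z^n(Y)) = 0 for every right R-module F that is a filtered colimit of modules of finite projective dimension admitting resolutions by finitely generated projective modules. -/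
open CategoryTheory CategoryTheory.Limits CategoryTheory.Abelian ZeroObject

universe w' w v u

section RelationSubmodules

variable {S : Type u} [Ring S]

/-- Every `Y^j`-valued linear map on `M` which is a cocycle on the submodule `A` is, on `A`, the
coboundary of a linear map on `M`. When the terms of `Y` are injective, this means that
`Hom(A, Y)` is acyclic. -/
def IsHomAcyclicOn (Y : CochainComplex (ModuleCat.{u} S) ℤ) {M : Type u} [AddCommGroup M]
    [Module S M] (A : Submodule S M) : Prop :=
  ∀ i j k : ℤ, i + 1 = j → j + 1 = k → ∀ f : M →ₗ[S] Y.X j,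
    (∀ a ∈ A, Y.d j k (f a) = 0) → ∃ g : M →ₗ[S] Y.X i, ∀ a ∈ A, Y.d i j (g a) = f a

lemma CochainComplex.d_d_apply (Y : CochainComplex (ModuleCat.{u} S) ℤ) (i j k : ℤ) (x : Y.X i) :
    Y.d j k (Y.d i j x) = 0 := by
  rw [← ModuleCat.comp_apply, Y.d_comp_d]
  rfl

/-- If `Hom(-, Y)` is acyclic on both `A` and `B`, then a primitive of `f` on `A` can be changed
outside of `A` to a primitive of `f` on `B`. -/
lemma IsHomAcyclicOn.exists_primitive_extending {Y : CochainComplex (ModuleCat.{u} S) ℤ}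
    {M : Type u} [AddCommGroup M] [Module S M] {A B : Submodule S M}
    (hA : IsHomAcyclicOn Y A) (hB : IsHomAcyclicOn Y B) (hAB : A ≤ B)
    {i j k : ℤ} (hij : i + 1 = j) (hjk : j + 1 = k) (f : M →ₗ[S] Y.X j)
    (hf : ∀ b ∈ B, Y.d j k (f b) = 0) (g : M →ₗ[S] Y.X i)
    (hg : ∀ a ∈ A, Y.d i j (g a) = f a) :
    ∃ g' : M →ₗ[S] Y.X i, (∀ b ∈ B, Y.d i j (g' b) = f b) ∧ ∀ a ∈ A, g' a = g a := by
  obtain ⟨p, hp⟩ := hB i j k hij hjk f hf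
  obtain ⟨h, hh⟩ := hA (i - 1) i j (by lia) hij (p - g) (fun a ha ↦ by
    rw [LinearMap.sub_apply, map_sub, hp a (hAB ha), hg a ha, sub_self])
  refine ⟨p - (Y.d (i - 1) i).hom ∘ₗ h, fun b hb ↦ ?_, fun a ha ↦ ?_⟩
  · rw [LinearMap.sub_apply, map_sub, hp b hb, LinearMap.comp_apply, Y.d_d_apply, sub_zero]
  · rw [LinearMap.sub_apply, LinearMap.comp_apply, hh a ha, LinearMap.sub_apply, sub_sub_cancel]

variable {X : Type u} (V : Finset X ⥤ ModuleCat.{u} S)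

open scoped Classical in
/-- The inclusion of a term of a diagram into the direct sum of its terms. -/
noncomputable abbrev diagramLof (A : Finset X) :
    V.obj A →ₗ[S] DirectSum (Finset X) fun A ↦ V.obj A :=
  DirectSum.lof S (Finset X) (fun A ↦ V.obj A) A

/-- The submodule of the direct sum of the `V.obj A` which is generated by the relations defining
the colimit of the restriction of `V` to the finite subsets of `T`. -/
noncomputable def relSubmodule (T : Set X) :
    Submodule S (DirectSum (Finset X) fun A ↦ V.obj A) :=
  Submodule.span S {z | ∃ (A B : Finset X) (h : A ≤ B) (y : V.obj A), (B : Set X) ⊆ T ∧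
    z = diagramLof V A y - diagramLof V B (V.map (homOfLE h) y)}

variable {V}

lemma diagramLof_sub_mem_relSubmodule {T : Set X} {A B : Finset X} (h : A ≤ B)
    (hB : (B : Set X) ⊆ T) (y : V.obj A) :
    diagramLof V A y - diagramLof V B (V.map (homOfLE h) y) ∈ relSubmodule V T :=
  Submodule.subset_span ⟨A, B, h, y, hB, rfl⟩

lemma relSubmodule_mono {T T' : Set X} (h : T ⊆ T') : relSubmodule V T ≤ relSubmodule V T' :=
  Submodule.span_mono fun _ ⟨A, B, hAB, y, hB, hz⟩ ↦ ⟨A, B, hAB, y, hB.trans h, hz⟩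

lemma relSubmodule_induction {T : Set X} {N : Type*} [AddCommGroup N] [Module S N]
    {f g : (DirectSum (Finset X) fun A ↦ V.obj A) →ₗ[S] N}
    (h : ∀ (A B : Finset X) (hAB : A ≤ B) (y : V.obj A), (B : Set X) ⊆ T →
      f (diagramLof V A y - diagramLof V B (V.map (homOfLE hAB) y)) =
        g (diagramLof V A y - diagramLof V B (V.map (homOfLE hAB) y))) :
    ∀ a ∈ relSubmodule V T, f a = g a := by
  intro a ha
  refine LinearMap.eqOn_span (f := f) (g := g) ?_ ha
  rintro _ ⟨A, B, hAB, y, hB, rfl⟩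
  exact h A B hAB y hB

variable {Y : CochainComplex (ModuleCat.{u} S) ℤ}

lemma isHomAcyclicOn_relSubmodule_of_finite
    (hV : ∀ A, IsHomAcyclicOn Y (⊤ : Submodule S (V.obj A))) {T : Set X} (hT : T.Finite) :
    IsHomAcyclicOn Y (relSubmodule V T) := by
  classical
  intro i j k hij hjk f hf
  set m : Finset X := hT.toFinset with hm
  have le_m {B : Finset X} (hB : (B : Set X) ⊆ T) : B ≤ m := fun x hx ↦ by
    simpa [hm] using hB hx
  have m_sub : (m : Set X) ⊆ T := by simp [hm]
  let φ (A : Finset X) (h : A ≤ m) : V.obj A →ₗ[S] DirectSum (Finset X) fun A ↦ V.obj A :=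
    diagramLof V A - diagramLof V m ∘ₗ (V.map (homOfLE h)).hom
  have φm : φ m le_rfl = 0 := by
    ext1 y
    change diagramLof V m y - diagramLof V m (V.map (𝟙 m) y) = 0
    rw [V.map_id, ModuleCat.id_apply, sub_self]
  choose g hg using fun (A : Finset X) (h : A ≤ m) ↦ hV A i j k hij hjk (f ∘ₗ φ A h)
    (fun a _ ↦ hf _ (diagramLof_sub_mem_relSubmodule h m_sub a))
  let G : (DirectSum (Finset X) fun A ↦ V.obj A) →ₗ[S] Y.X i :=
    DirectSum.toModule S _ _ fun A ↦ if h : A < m then g A h.le else 0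
  have G_lof (A : Finset X) (h : A ≤ m) (y : V.obj A) :
      Y.d i j (G (diagramLof V A y)) = f (φ A h y) := by
    dsimp only [G, diagramLof]
    rw [DirectSum.toModule_lof]
    obtain rfl | h' := eq_or_lt_of_le h
    · rw [φm]
      simp
    · rw [dif_pos h']
      exact hg A h y trivial
  refine ⟨G, relSubmodule_induction (f := (Y.d i j).hom ∘ₗ G) fun A B hAB y hB ↦ ?_⟩
  have hB' := le_m hB
  rw [LinearMap.comp_apply, map_sub, map_sub]
  refine (congrArg₂ _ (G_lof A (hAB.trans hB') y) (G_lof B hB' _)).trans ?_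
  rw [← map_sub]
  congr 1
  have : V.map (homOfLE (hAB.trans hB')) y =
      V.map (homOfLE hB') (V.map (homOfLE hAB) y) := by
    rw [← ModuleCat.comp_apply, ← V.map_comp]
    rfl
  change (diagramLof V A y - diagramLof V m (V.map (homOfLE _) y)) -
    (diagramLof V B _ - diagramLof V m (V.map (homOfLE _) _)) = _
  rw [this]
  abel

lemma relSubmodule_sUnion_le {c : Set (Set X)} (hc : c.Nonempty) (hdir : DirectedOn (· ⊆ ·) c)
    {N : Submodule S (DirectSum (Finset X) fun A ↦ V.obj A)}
    (hN : ∀ T ∈ c, relSubmodule V T ≤ N) : relSubmodule V (⋃₀ c) ≤ N := by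
  refine Submodule.span_le.2 ?_
  rintro _ ⟨A, B, hAB, y, hB, rfl⟩
  obtain ⟨T, hT, hBT⟩ := DirectedOn.exists_mem_subset_of_finset_subset_biUnion hc
    (f := id) hdir (by simpa [Set.sUnion_eq_biUnion] using hB)
  exact hN T hT (diagramLof_sub_mem_relSubmodule hAB hBT y)

lemma isHomAcyclicOn_relSubmodule (hinj : ∀ n, Injective (Y.X n))
    (hV : ∀ A, IsHomAcyclicOn Y (⊤ : Submodule S (V.obj A))) (T : Set X) :
    IsHomAcyclicOn Y (relSubmodule V T) := by
  induction hκ : Cardinal.mk T using WellFoundedLT.induction generalizing T with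
  | ind κ ih =>
  by_cases hT : T.Finite
  · exact isHomAcyclicOn_relSubmodule_of_finite hV hT
  subst hκ
  have hT' : Cardinal.aleph0 ≤ Cardinal.mk T := Cardinal.aleph0_le_mk_iff.2
    (Set.infinite_coe_iff.2 hT)
  obtain ⟨e⟩ := Cardinal.eq.1 (Cardinal.mk_ord_toType (Cardinal.mk T)).symm
  intro i j k hij hjk f hf
  have := hinj i
  have := Module.injective_module_of_injective_object S (Y.X i)
  let Z : Set (Set X × ((DirectSum (Finset X) fun A ↦ V.obj A) →ₗ.[S] Y.X i)) :=
    {p | p.1 ⊆ T ∧ (∀ x y : T, (x : X) ∈ p.1 → e y ≤ e x → (y : X) ∈ p.1) ∧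
      p.2.domain = relSubmodule V p.1 ∧ ∀ a : p.2.domain, Y.d i j (p.2 a) = f a}
  obtain ⟨⟨L, p⟩, ⟨hLT, hLe, hdom, hp⟩, hmax⟩ : ∃ m, Maximal (· ∈ Z) m := by
    obtain ⟨g₀, hg₀⟩ := isHomAcyclicOn_relSubmodule_of_finite hV Set.finite_empty i j k hij hjk f
      fun b hb ↦ hf b (relSubmodule_mono (Set.empty_subset T) hb)
    refine (zorn_le_nonempty₀ Z (fun c hcZ hc q₀ hq₀ ↦ ?_)
      (∅, ⟨relSubmodule V ∅, g₀.domRestrict (relSubmodule V ∅)⟩)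
      ⟨Set.empty_subset T, fun _ _ h _ ↦ h.elim, rfl, fun a ↦ hg₀ a a.2⟩).imp fun _ ↦ And.right
    have hdir₁ : DirectedOn (· ⊆ ·) (Prod.fst '' c) :=
      (hc.image_of_map_rel _ _ _ fun _ _ h ↦ h.1).directedOn
    have hdir₂ : DirectedOn (· ≤ ·) (Prod.snd '' c) :=
      (hc.image_of_map_rel _ _ _ fun _ _ h ↦ h.2).directedOn
    refine ⟨(⋃₀ (Prod.fst '' c), LinearPMap.sSup _ hdir₂), ⟨?_, ?_, ?_, ?_⟩, fun q hq ↦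
      ⟨Set.subset_sUnion_of_mem (Set.mem_image_of_mem _ hq),
        LinearPMap.le_sSup hdir₂ (Set.mem_image_of_mem _ hq)⟩⟩
    · rintro x ⟨_, ⟨q, hq, rfl⟩, hx⟩
      exact (hcZ hq).1 hx
    · rintro x y ⟨_, ⟨q, hq, rfl⟩, hx⟩ hyx
      exact ⟨_, ⟨q, hq, rfl⟩, (hcZ hq).2.1 x y hx hyx⟩
    · rw [LinearPMap.domain_sSup]
      refine le_antisymm (sSup_le ?_)
        (relSubmodule_sUnion_le (Set.Nonempty.image _ ⟨q₀, hq₀⟩) hdir₁ ?_)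
      · rintro _ ⟨_, ⟨q, hq, rfl⟩, rfl⟩
        rw [(hcZ hq).2.2.1]
        exact relSubmodule_mono (Set.subset_sUnion_of_mem (Set.mem_image_of_mem _ hq))
      · rintro _ ⟨q, hq, rfl⟩
        rw [← (hcZ hq).2.2.1]
        exact le_sSup ⟨_, ⟨q, hq, rfl⟩, rfl⟩
    · rintro ⟨a, ha⟩
      obtain ⟨_, ⟨q, hq, rfl⟩, haq⟩ :=
        (LinearPMap.mem_domain_sSup_iff (Set.Nonempty.image _ ⟨q₀, hq₀⟩) hdir₂).1 ha
      have := LinearPMap.sSup_apply hdir₂ (Set.mem_image_of_mem _ hq) ⟨a, haq⟩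
      exact (congrArg _ this).trans ((hcZ hq).2.2.2 ⟨a, haq⟩)
  have hext : ∃ g : (DirectSum (Finset X) fun A ↦ V.obj A) →ₗ[S] Y.X i,
      ∀ a : p.domain, g a = p a :=
    Module.Injective.out p.domain.subtype p.domain.injective_subtype p.toFun
  obtain ⟨g, hg⟩ := hext
  have hgL (a) (ha : a ∈ relSubmodule V L) : Y.d i j (g a) = f a := by
    rw [← hdom] at ha
    rw [← hp ⟨a, ha⟩, ← hg]
  suffices h : L = T by
    subst h
    exact ⟨g, hgL⟩
  by_contra hne
  obtain ⟨x, hxL, hx⟩ : ∃ x : T, (x : X) ∉ L ∧ ∀ y : T, e y < e x → (y : X) ∈ L := by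
    obtain ⟨x₀, hx₀T, hx₀L⟩ := Set.exists_of_ssubset (hLT.ssubset_of_ne hne)
    let W : Set T := {y | (y : X) ∉ L}
    have wf : WellFounded fun y z : T ↦ e y < e z := InvImage.wf e wellFounded_lt
    have hW : W.Nonempty := ⟨⟨x₀, hx₀T⟩, hx₀L⟩
    exact ⟨wf.min W hW, wf.min_mem W hW, fun y hy ↦ by_contra fun h ↦
      wf.not_lt_min W (x := y) h hy⟩
  let L' := insert (x : X) L
  have hL'T : L' ⊆ T := Set.insert_subset x.2 hLT
  have hcard : Cardinal.mk L < Cardinal.mk T := by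
    refine (Cardinal.mk_le_of_injective (f := fun y : L ↦
      (⟨e ⟨y, hLT y.2⟩, ?_⟩ : Set.Iio (e x))) ?_).trans_lt 
        ((Cardinal.mk_Iio_lt (e x) (by simp)).trans_eq (by simp))
    · exact lt_of_not_ge fun h ↦ hxL (hLe ⟨y, hLT y.2⟩ x y.2 h)
    · intro y z hyz
      exact Subtype.ext (Subtype.mk.inj (e.injective (congrArg Subtype.val hyz)))
  have hcard' : Cardinal.mk L' < Cardinal.mk T :=
    (Cardinal.mk_insert_le).trans_lt (Cardinal.add_lt_of_lt hT' hcard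
      (Cardinal.one_lt_aleph0.trans_le hT'))
  obtain ⟨g', hg', hgg'⟩ := (ih _ hcard L rfl).exists_primitive_extending (ih _ hcard' L' rfl)
    (relSubmodule_mono (Set.subset_insert _ _)) hij hjk f
    (fun b hb ↦ hf b (relSubmodule_mono hL'T hb)) g hgL
  have hmem : (L', (⟨relSubmodule V L', g'.domRestrict _⟩ : _ →ₗ.[S] _)) ∈ Z := by
    refine ⟨hL'T, ?_, rfl, fun a ↦ hg' a a.2⟩
    rintro y z (hy | hy) hzy
    · obtain rfl := Subtype.ext hy
      obtain h | h := hzy.lt_or_eq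
      · exact Or.inr (hx z h)
      · exact Or.inl (congrArg Subtype.val (e.injective h))
    · exact Or.inr (hLe y z hy hzy)
  refine hxL ((hmax hmem ⟨Set.subset_insert _ _, ?_, ?_⟩).1 (Set.mem_insert _ _))
  · exact hdom.le.trans (relSubmodule_mono (Set.subset_insert _ _))
  · intro a b hab
    have : g' a = g a := hgg' a (hdom ▸ a.2)
    rw [← hg, ← this, hab]
    rfl

lemma isHomAcyclicOn_top_of_isColimit (hinj : ∀ n, Injective (Y.X n))
    (hV : ∀ A, IsHomAcyclicOn Y (⊤ : Submodule S (V.obj A))) {c : Cocone V} (hc : IsColimit c) :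
    IsHomAcyclicOn Y (⊤ : Submodule S c.pt) := by
  classical
  intro i j k hij hjk f hf
  choose g hg using fun A ↦ hV A i j k hij hjk (f ∘ₗ (c.ι.app A).hom)
    (fun a _ ↦ hf (c.ι.app A a) trivial)
  let G : (DirectSum (Finset X) fun A ↦ V.obj A) →ₗ[S] Y.X i := DirectSum.toModule S _ _ g
  have G_lof (A : Finset X) (y : V.obj A) : G (diagramLof V A y) = g A y :=
    DirectSum.toModule_lof ..
  have w {A B : Finset X} (hAB : A ≤ B) (y : V.obj A) :
      c.ι.app B (V.map (homOfLE hAB) y) = c.ι.app A y := by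
    rw [← ModuleCat.comp_apply, c.w]
  obtain ⟨h, hh⟩ := isHomAcyclicOn_relSubmodule hinj hV Set.univ (i - 1) i j (by lia) hij G
    (relSubmodule_induction (f := (Y.d i j).hom ∘ₗ G) (g := 0) fun A B hAB y _ ↦ by
      rw [LinearMap.comp_apply, map_sub, G_lof, G_lof, map_sub]
      refine (congrArg₂ _ (hg A y trivial) (hg B _ trivial)).trans ?_
      change f (c.ι.app A y) - f (c.ι.app B (V.map (homOfLE hAB) y)) = 0
      rw [w, sub_self])
  let G' := G - (Y.d (i - 1) i).hom ∘ₗ h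
  let s : Cocone V :=
    { pt := Y.X i
      ι :=
        { app A := ModuleCat.ofHom (G' ∘ₗ diagramLof V A)
          naturality A B φ := by
            ext y
            have hAB := leOfHom φ
            have := hh _ (diagramLof_sub_mem_relSubmodule hAB (Set.subset_univ _) y)
            have h0 : G' (diagramLof V A y - diagramLof V B (V.map (homOfLE hAB) y)) = 0 :=
              sub_eq_zero.2 this.symm
            rw [map_sub, sub_eq_zero] at h0
            exact h0.symm } }
  have hs : hc.desc s ≫ Y.d i j = ModuleCat.ofHom f := hc.hom_ext fun A ↦ by
    rw [hc.fac_assoc]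
    ext y
    change Y.d i j (G (diagramLof V A y) - Y.d (i - 1) i (h _)) = f (c.ι.app A y)
    rw [map_sub, Y.d_d_apply, sub_zero, G_lof]
    exact hg A y trivial
  exact ⟨(hc.desc s).hom, fun a _ ↦ congr($hs a)⟩

lemma isHomAcyclicOn_top_iff {A : ModuleCat.{u} S} :
    IsHomAcyclicOn Y (⊤ : Submodule S A) ↔ ∀ i j k : ℤ, i + 1 = j → j + 1 = k →
      ∀ f : A ⟶ Y.X j, f ≫ Y.d j k = 0 → ∃ g : A ⟶ Y.X i, g ≫ Y.d i j = f := by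
  refine ⟨fun h i j k hij hjk f hf ↦ ?_, fun h i j k hij hjk f hf ↦ ?_⟩
  · obtain ⟨g, hg⟩ := h i j k hij hjk f.hom fun a _ ↦ congr($hf a)
    exact ⟨ModuleCat.ofHom g, by ext a; exact hg a trivial⟩
  · obtain ⟨g, hg⟩ := h i j k hij hjk (ModuleCat.ofHom f) (by ext a; exact hf a trivial)
    exact ⟨g.hom, fun a _ ↦ congr($hg a)⟩

end RelationSubmodules

lemma exists_monotone_finset_of_isDirected (α : Type*) [PartialOrder α] [IsDirected α (· ≤ ·)]
    [Nonempty α] : ∃ v : Finset α → α, Monotone v ∧ ∀ a, a ≤ v {a} := by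
  classical
  choose M hM using fun s : Finset α ↦ s.exists_le
  let F (s : Finset α) (ih : ∀ t ⊂ s, α) : α :=
    M (s ∪ s.ssubsets.attach.image fun t ↦ ih t.1 (Finset.mem_ssubsets.1 t.2))
  refine ⟨Finset.strongInduction F, fun s t hst ↦ ?_, fun a ↦ ?_⟩
  · obtain rfl | hst := eq_or_ssubset_of_subset hst
    · rfl
    · rw [Finset.strongInduction_eq F t]
      exact hM _ _ (Finset.mem_union_right _ (Finset.mem_image.2
        ⟨⟨s, Finset.mem_ssubsets.2 hst⟩, Finset.mem_attach _ _, rfl⟩))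
  · rw [Finset.strongInduction_eq]
    exact hM _ _ (Finset.mem_union_left _ (Finset.mem_singleton_self a))

lemma exists_final_finset_functor (J : Type u) [SmallCategory J] [IsFiltered J] :
    ∃ (X : Type u) (G : Finset X ⥤ J), G.Final := by
  obtain ⟨X, _, _, _, G, _⟩ := IsFiltered.exists_directed J
  obtain ⟨v, hv, hv'⟩ := exists_monotone_finset_of_isDirected X
  have : hv.functor.Final := (hv.final_functor_iff).2 fun a ↦ ⟨{a}, hv' a⟩
  exact ⟨X, hv.functor ⋙ G, inferInstance⟩

section Ext

variable {C : Type u} [Category.{v} C] [Abelian C] {Y : CochainComplex C ℤ}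

/-- The short complex `Z^i(Y) ⟶ Y^i ⟶ Z^j(Y)`. -/
noncomputable abbrev cyclesShortComplex (Y : CochainComplex C ℤ) (i j : ℤ) : ShortComplex C :=
  ShortComplex.mk (Y.iCycles i) (Y.toCycles i j) (by
    rw [← cancel_mono (Y.iCycles j), Category.assoc, Y.toCycles_i, Y.iCycles_d, zero_comp])

lemma cyclesShortComplex_shortExact (hac : ∀ n : ℤ, Y.ExactAt n) {i j : ℤ} (hij : i + 1 = j) :
    (cyclesShortComplex Y i j).ShortExact := by
  have hepi : Epi (Y.toCycles i j) :=
    Preadditive.epi_of_isZero_cokernel' _ (Y.homologyIsCokernel i j (by simp [← hij]))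
      ((Y.exactAt_iff_isZero_homology j).1 (hac j))
  let φ : cyclesShortComplex Y i j ⟶ ShortComplex.mk (Y.iCycles i) (Y.d i j) (Y.iCycles_d i j) :=
    { τ₁ := 𝟙 _
      τ₂ := 𝟙 _
      τ₃ := Y.iCycles j }
  have hex : (cyclesShortComplex Y i j).Exact :=
    (ShortComplex.exact_iff_of_epi_of_isIso_of_mono φ).2
      (ShortComplex.exact_of_f_is_kernel _ (Y.cyclesIsKernel i j (by simp [← hij])))
  exact { exact := hex, mono_f := inferInstanceAs (Mono (Y.iCycles i)), epi_g := hepi }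

variable [HasExt.{w} C]

lemma exists_primitive_of_subsingleton_ext (hac : ∀ n : ℤ, Y.ExactAt n) {A : C}
    (hA : ∀ n, Subsingleton (Ext.{w} A (Y.cycles n) 1)) (i j k : ℤ) (hij : i + 1 = j)
    (hjk : j + 1 = k) (f : A ⟶ Y.X j) (hf : f ≫ Y.d j k = 0) :
    ∃ g : A ⟶ Y.X i, g ≫ Y.d i j = f := by
  have hS := cyclesShortComplex_shortExact hac hij
  obtain ⟨x, hx⟩ := Ext.covariant_sequence_exact₃ A hS
    (Ext.mk₀ (Y.liftCycles f k (by simp [← hjk]) hf)) (zero_add 1) ((hA i).elim _ _)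
  obtain ⟨g, rfl⟩ := Ext.addEquiv₀.symm.surjective x
  refine ⟨g, ?_⟩
  have : g ≫ Y.toCycles i j = Y.liftCycles f k (by simp [← hjk]) hf :=
    Ext.addEquiv₀.symm.injective (by simpa using hx)
  rw [← Y.toCycles_i i j, reassoc_of% this, Y.liftCycles_i]

lemma subsingleton_ext_cycles_of_exists_primitive (hac : ∀ n : ℤ, Y.ExactAt n)
    (hinj : ∀ n : ℤ, Injective (Y.X n)) {A : C}
    (hA : ∀ i j k : ℤ, i + 1 = j → j + 1 = k → ∀ f : A ⟶ Y.X j, f ≫ Y.d j k = 0 →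
      ∃ g : A ⟶ Y.X i, g ≫ Y.d i j = f) (n : ℤ) :
    Subsingleton (Ext.{w} A (Y.cycles n) 1) := by
  have hS := cyclesShortComplex_shortExact hac (i := n) rfl
  have := hinj n
  refine subsingleton_of_forall_eq 0 fun x ↦ ?_
  obtain ⟨y, rfl⟩ := Ext.covariant_sequence_exact₁ A hS x (Ext.eq_zero_of_injective _) (zero_add 1)
  obtain ⟨f, rfl⟩ := Ext.addEquiv₀.symm.surjective y
  obtain ⟨g, hg⟩ := hA n (n + 1) (n + 1 + 1) rfl rfl (f ≫ Y.iCycles (n + 1))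
    (by rw [Category.assoc, Y.iCycles_d, comp_zero])
  obtain rfl : g ≫ Y.toCycles n (n + 1) = f := by
    rw [← cancel_mono (Y.iCycles (n + 1)), Category.assoc, Y.toCycles_i, hg]
  rw [Ext.addEquiv₀_symm_apply, ← Ext.mk₀_comp_mk₀, Ext.comp_assoc_of_second_deg_zero,
    hS.comp_extClass, Ext.comp_zero]

/-- Dimension shifting: the vanishing of `Ext` into all the cycles of an acyclic complex of
injective objects in some positive degree implies the vanishing in degree `1`. -/
lemma subsingleton_ext_one_cycles_of_subsingleton_ext (hac : ∀ n : ℤ, Y.ExactAt n)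
    (hinj : ∀ n : ℤ, Injective (Y.X n)) {A : C} (m : ℕ)
    (hA : ∀ n, Subsingleton (Ext.{w} A (Y.cycles n) (m + 1))) (n : ℤ) :
    Subsingleton (Ext.{w} A (Y.cycles n) 1) := by
  induction m with
  | zero => exact hA n
  | succ m ih =>
    refine ih fun j ↦ subsingleton_of_forall_eq 0 fun x ↦ ?_
    have hS := cyclesShortComplex_shortExact hac (sub_add_cancel j 1)
    have := hinj (j - 1)
    obtain ⟨y, rfl⟩ := Ext.covariant_sequence_exact₃ A hS x rfl ((hA (j - 1)).elim _ _)
    rw [Ext.eq_zero_of_injective y, Ext.zero_comp]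

end Ext

/-- every cycle module of an acyclic complex of injective right `R`-modules
belongs to `ℬ_∞`.  Right `R`-modules are modules over `Rᵐᵒᵖ`. -/
theorem stmt10 (R : Type u) [Ring R] [HasExt.{w} (ModuleCat.{u} Rᵐᵒᵖ)]
    (Y : CochainComplex (ModuleCat.{u} Rᵐᵒᵖ) ℤ)
    (hac : ∀ n : ℤ, Y.ExactAt n) (hinj : ∀ n : ℤ, Injective (Y.X n)) :
    ∀ (n : ℤ) (F : ModuleCat.{u} Rᵐᵒᵖ), MemAInfty R F →
      Subsingleton (Abelian.Ext.{w} F (Y.cycles n) 1) := by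
  rintro n F ⟨J, _, _, D, c, hD, ⟨hc⟩, ⟨e⟩⟩
  obtain ⟨X, G, _⟩ := exists_final_finset_functor J
  have hV (A : Finset X) : IsHomAcyclicOn Y (⊤ : Submodule Rᵐᵒᵖ ((G ⋙ D).obj A)) := by
    obtain ⟨⟨m, hm⟩, -⟩ := hD (G.obj A)
    exact isHomAcyclicOn_top_iff.2 (exists_primitive_of_subsingleton_ext hac
      (subsingleton_ext_one_cycles_of_subsingleton_ext hac hinj m
        fun n ↦ hm _ _ (Nat.lt_succ_self m)))
  have hcF : IsColimit ((c.extend e.hom).whisker G) :=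
    (Functor.Final.isColimitWhiskerEquiv G _).symm (hc.extendIso e.hom)
  exact subsingleton_ext_cycles_of_exists_primitive hac hinj
    (isHomAcyclicOn_top_iff.1 (isHomAcyclicOn_top_of_isColimit hinj hV hcF)) n
end

section
/- Let (𝒜, ℬ) be a complete hereditary cotorsion pair in a Grothendieck category G, and let Y be an unbounded cochain complex all of whose components lie in ℬ such that Ext^1_{Ch(G)}(X, Y) = 0 for every complex X ∈ ℬ~ (acyclic with components and cycles in ℬ). Then every component of Y is an injective object of G; that is, ℬ~^⊥ ∩ dwℬ ⊆ dwInj. -/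
open CategoryTheory CategoryTheory.Limits CategoryTheory.Abelian ZeroObject

universe w' w v u

namespace HomologicalComplex

variable {C : Type u} [Category.{v} C] [Abelian C] {ι : Type*} {c : ComplexShape ι} {i₀ i₁ : ι}

/-- The morphism of disk complexes induced by a morphism of objects. -/
noncomputable def doubleIdMap (h₀₁ : c.Rel i₀ i₁) (h : i₀ ≠ i₁) {X Y : C} (f : X ⟶ Y) :
    double (𝟙 X) h₀₁ ⟶ double (𝟙 Y) h₀₁ :=
  mkHomFromDouble h₀₁ h (f ≫ (doubleXIso₀ (𝟙 Y) h₀₁).inv) (f ≫ (doubleXIso₁ (𝟙 Y) h₀₁ h).inv)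
    (by simp [double_d _ _ h]) (fun k _ => by
      rw [double_d_eq_zero₀ _ _ _ _ h.symm, comp_zero])

lemma doubleIdMap_comp (h₀₁ : c.Rel i₀ i₁) (h : i₀ ≠ i₁) {X Y Z : C} (f : X ⟶ Y) (g : Y ⟶ Z) :
    doubleIdMap h₀₁ h f ≫ doubleIdMap h₀₁ h g = doubleIdMap h₀₁ h (f ≫ g) := by
  ext <;> simp [doubleIdMap]

lemma doubleIdMap_zero (h₀₁ : c.Rel i₀ i₁) (h : i₀ ≠ i₁) (X Y : C) :
    doubleIdMap h₀₁ h (0 : X ⟶ Y) = 0 := by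
  ext <;> simp [doubleIdMap]

/-- The disk complexes on the terms of a short complex. -/
noncomputable def doubleIdShortComplex (h₀₁ : c.Rel i₀ i₁) (h : i₀ ≠ i₁) (S : ShortComplex C) :
    ShortComplex (HomologicalComplex C c) :=
  ShortComplex.mk (doubleIdMap h₀₁ h S.f) (doubleIdMap h₀₁ h S.g)
    (by rw [doubleIdMap_comp, S.zero, doubleIdMap_zero])

lemma shortExact_doubleIdShortComplex (h₀₁ : c.Rel i₀ i₁) (h : i₀ ≠ i₁) {S : ShortComplex C}
    (hS : S.ShortExact) : (doubleIdShortComplex h₀₁ h S).ShortExact := by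
  refine shortExact_of_degreewise_shortExact _ fun k => ?_
  by_cases hk₀ : k = i₀
  · subst hk₀
    refine ShortComplex.shortExact_of_iso (ShortComplex.isoMk
      (doubleXIso₀ (𝟙 S.X₁) h₀₁).symm (doubleXIso₀ (𝟙 S.X₂) h₀₁).symm
      (doubleXIso₀ (𝟙 S.X₃) h₀₁).symm ?_ ?_) hS <;>
    · simp only [doubleIdShortComplex, doubleIdMap, ShortComplex.map_f, ShortComplex.map_g,
        eval_map, mkHomFromDouble_f₀, Iso.symm_hom]
      exact Iso.inv_hom_id_assoc _ _
  by_cases hk₁ : k = i₁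
  · subst hk₁
    refine ShortComplex.shortExact_of_iso (ShortComplex.isoMk
      (doubleXIso₁ (𝟙 S.X₁) h₀₁ h).symm (doubleXIso₁ (𝟙 S.X₂) h₀₁ h).symm
      (doubleXIso₁ (𝟙 S.X₃) h₀₁ h).symm ?_ ?_) hS <;>
    · simp only [doubleIdShortComplex, doubleIdMap, ShortComplex.map_f, ShortComplex.map_g,
        eval_map, mkHomFromDouble_f₁, Iso.symm_hom]
      exact Iso.inv_hom_id_assoc _ _
  have hz (X : C) : IsZero ((double (𝟙 X) h₀₁).X k) := isZero_double_X _ _ _ hk₀ hk₁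
  exact
    { exact := ShortComplex.exact_of_isZero_X₂ _ (hz _)
      mono_f := ⟨fun _ _ _ => (hz S.X₁).eq_of_tgt _ _⟩
      epi_g := ⟨fun _ _ _ => (hz S.X₃).eq_of_src _ _⟩ }

lemma isIso_double_id_d (h₀₁ : c.Rel i₀ i₁) (h : i₀ ≠ i₁) (X : C) :
    IsIso ((double (𝟙 X) h₀₁).d i₀ i₁) := by
  rw [double_d _ _ h]
  infer_instance

lemma exactAt_double_id (h₀₁ : c.Rel i₀ i₁) (h : i₀ ≠ i₁) (X : C) (k : ι) :
    (double (𝟙 X) h₀₁).ExactAt k := by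
  have := isIso_double_id_d h₀₁ h X
  by_cases hk₀ : k = i₀
  · subst hk₀
    rw [exactAt_iff' _ _ k i₁ rfl (c.next_eq' h₀₁), ShortComplex.exact_iff_mono]
    · exact inferInstanceAs (Mono ((double (𝟙 X) h₀₁).d k i₁))
    · exact double_d_eq_zero₁ _ h₀₁ _ _ h
  by_cases hk₁ : k = i₁
  · subst hk₁
    rw [exactAt_iff' _ i₀ k _ (c.prev_eq' h₀₁) rfl, ShortComplex.exact_iff_epi]
    · exact inferInstanceAs (Epi ((double (𝟙 X) h₀₁).d i₀ k))
    · exact double_d_eq_zero₀ _ h₀₁ _ _ h.symm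
  exact ExactAt.of_isZero (isZero_double_X _ _ _ hk₀ hk₁)

lemma isZero_cycles_double_id (h₀₁ : c.Rel i₀ i₁) (h : i₀ ≠ i₁) (X : C) (k : ι) (hk : k ≠ i₁) :
    IsZero ((double (𝟙 X) h₀₁).cycles k) := by
  rw [IsZero.iff_id_eq_zero, ← cancel_mono ((double (𝟙 X) h₀₁).iCycles k)]
  by_cases hk₀ : k = i₀
  · subst hk₀
    have := isIso_double_id_d h₀₁ h X
    rw [← cancel_mono ((double (𝟙 X) h₀₁).d k i₁)]
    simp
  · exact (isZero_double_X _ _ _ hk₀ hk).eq_of_tgt _ _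

/-- The cycles of a disk complex in its top degree. -/
noncomputable def cyclesDoubleIdIso (h₀₁ : c.Rel i₀ i₁) (h : i₀ ≠ i₁) (X : C) :
    (double (𝟙 X) h₀₁).cycles i₁ ≅ X :=
  have := (double (𝟙 X) h₀₁).isIso_iCycles i₁ _ rfl (double_d_eq_zero₀ _ _ _ _ h.symm)
  asIso ((double (𝟙 X) h₀₁).iCycles i₁) ≪≫ doubleXIso₁ (𝟙 X) h₀₁ h

/-- If a disk complex on `S.X₃` has no `Ext¹` to `K`, then maps `S.X₁ ⟶ K.X i₀` extend along
the monomorphism `S.f`. -/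
lemma exists_extension_of_subsingleton_ext [HasExt.{w'} (HomologicalComplex C c)]
    (h₀₁ : c.Rel i₀ i₁) (h : i₀ ≠ i₁) {S : ShortComplex C} (hS : S.ShortExact)
    (K : HomologicalComplex C c) [Subsingleton (Ext.{w'} (double (𝟙 S.X₃) h₀₁) K 1)]
    (φ : S.X₁ ⟶ K.X i₀) : ∃ ψ : S.X₂ ⟶ K.X i₀, S.f ≫ ψ = φ := by
  let Φ : double (𝟙 S.X₁) h₀₁ ⟶ K :=
    mkHomFromDouble h₀₁ h φ (φ ≫ K.d i₀ i₁) (by simp) (by simp)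
  obtain ⟨x, hx⟩ := Ext.contravariant_sequence_exact₁
    (shortExact_doubleIdShortComplex h₀₁ h hS) K (Ext.mk₀ Φ) (add_zero 1)
    (Subsingleton.elim (α := Ext.{w'} (double (𝟙 S.X₃) h₀₁) K 1) _ _)
  obtain ⟨Ψ, rfl⟩ : ∃ Ψ : double (𝟙 S.X₂) h₀₁ ⟶ K, Ext.mk₀ Ψ = x :=
    (Ext.mk₀_bijective _ _).2 x
  replace hx : doubleIdMap h₀₁ h S.f ≫ Ψ = Φ :=
    (Ext.mk₀_bijective _ _).1 ((Ext.mk₀_comp_mk₀ (doubleIdMap h₀₁ h S.f) Ψ).symm.trans hx)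
  refine ⟨(doubleXIso₀ (𝟙 S.X₂) h₀₁).inv ≫ Ψ.f i₀, ?_⟩
  have := congr_arg (fun α => (doubleXIso₀ (𝟙 S.X₁) h₀₁).inv ≫ α.f i₀) hx
  simpa [doubleIdMap, Φ] using this

end HomologicalComplex

lemma IsCotorsionPair.mem_right_of_retract {C : Type u} [Category.{v} C] [Abelian C] [HasExt.{w} C]
    {𝒜 ℬ : Set C} (hcp : IsCotorsionPair C 𝒜 ℬ) {X Y : C} (r : Retract X Y) (hY : Y ∈ ℬ) :
    X ∈ ℬ := by
  refine (hcp.mem_right_iff X).2 fun A hA => subsingleton_of_forall_eq 0 fun x => ?_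
  have := (hcp.mem_right_iff Y).1 hY A hA
  rw [← x.comp_mk₀_id, ← r.retract, ← Ext.mk₀_comp_mk₀,
    ← Ext.comp_assoc_of_third_deg_zero,
    Subsingleton.elim (x.comp (Ext.mk₀ r.i) (add_zero 1)) 0, Ext.zero_comp]

/-- The right class of a hereditary cotorsion pair is closed under cosyzygies. -/
lemma IsCompleteHereditaryCotorsionPair.mem_right_of_shortExact {C : Type u} [Category.{v} C]
    [Abelian C] [HasExt.{w} C] {𝒜 ℬ : Set C} (hcp : IsCompleteHereditaryCotorsionPair C 𝒜 ℬ)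
    {S : ShortComplex C} (hS : S.ShortExact) (h₁ : S.X₁ ∈ ℬ) (h₂ : S.X₂ ∈ ℬ) : S.X₃ ∈ ℬ := by
  refine (hcp.mem_right_iff _).2 fun A hA => subsingleton_of_forall_eq 0 fun x => ?_
  have := hcp.hereditary A hA _ h₁ 2 (by norm_num)
  have := hcp.hereditary A hA _ h₂ 1 le_rfl
  obtain ⟨y, rfl⟩ := Ext.covariant_sequence_exact₃ A hS x (n₁ := 2) rfl (Subsingleton.elim _ _)
  rw [Subsingleton.elim y 0, Ext.zero_comp]

/-- for a complete hereditary cotorsion pair `(𝒜, ℬ)` in a Grothendieck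
category, a complex `Y` with components in `ℬ` which is right `Ext¹`-orthogonal (in `Ch(G)`)
to all complexes in `ℬ~` has injective components: `ℬ~^⊥ ∩ dwℬ ⊆ dwInj`. -/
theorem stmt13 (C : Type u) [Category.{v} C] [Abelian C]
    [HasFilteredColimits C] [AB5 C] [HasSeparator C]
    [HasExt.{w} C] [HasExt.{w'} (CochainComplex C ℤ)]
    (𝒜 ℬ : Set C) (hcp : IsCompleteHereditaryCotorsionPair C 𝒜 ℬ)
    (Y : CochainComplex C ℤ) (hY : ∀ n : ℤ, Y.X n ∈ ℬ)
    (horth : ∀ X : CochainComplex C ℤ, (∀ n : ℤ, X.ExactAt n) → (∀ n : ℤ, X.X n ∈ ℬ) →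
      (∀ n : ℤ, X.cycles n ∈ ℬ) → Subsingleton (Abelian.Ext.{w'} X Y 1)) :
    ∀ n : ℤ, Injective (Y.X n) := by
  intro n
  have : IsGrothendieckAbelian.{v} C := {}
  let S := ShortComplex.mk (Injective.ι (Y.X n)) (cokernel.π _) (cokernel.condition _)
  have hS : S.ShortExact :=
    { exact := ShortComplex.exact_cokernel _
      mono_f := inferInstanceAs (Mono (Injective.ι (Y.X n)))
      epi_g := inferInstanceAs (Epi (cokernel.π (Injective.ι (Y.X n)))) }
  have h_zero (Z : C) (hZ : IsZero Z) : Z ∈ ℬ :=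
    hcp.mem_right_of_retract ⟨0, 0, hZ.eq_of_src _ _⟩ (hY n)
  have h_inj : S.X₂ ∈ ℬ := (hcp.mem_right_iff _).2 fun A _ =>
    have : Injective S.X₂ := inferInstanceAs (Injective (Injective.under (Y.X n)))
    subsingleton_of_forall_eq 0 Ext.eq_zero_of_injective
  have h_coker : S.X₃ ∈ ℬ := hcp.mem_right_of_shortExact hS (hY n) h_inj
  have h_rel : (ComplexShape.up ℤ).Rel n (n + 1) := rfl
  have h_ne : n ≠ n + 1 := by lia
  have := horth (HomologicalComplex.double (𝟙 S.X₃) h_rel)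
    (HomologicalComplex.exactAt_double_id h_rel h_ne _)
    (fun k => by
      by_cases hk₀ : k = n
      · subst hk₀
        exact hcp.mem_right_of_retract (HomologicalComplex.doubleXIso₀ _ h_rel).retract h_coker
      by_cases hk₁ : k = n + 1
      · subst hk₁
        exact hcp.mem_right_of_retract
          (HomologicalComplex.doubleXIso₁ _ h_rel h_ne).retract h_coker
      exact h_zero _ (HomologicalComplex.isZero_double_X _ _ _ hk₀ hk₁))
    (fun k => by
      by_cases hk : k = n + 1
      · subst hk
        exact hcp.mem_right_of_retract
          (HomologicalComplex.cyclesDoubleIdIso h_rel h_ne _).retract h_coker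
      exact h_zero _ (HomologicalComplex.isZero_cycles_double_id h_rel h_ne _ _ hk))
  obtain ⟨r, hr⟩ :=
    HomologicalComplex.exists_extension_of_subsingleton_ext h_rel h_ne hS Y (𝟙 (Y.X n))
  exact (Retract.mk (Injective.ι (Y.X n)) r hr).injective
end

section
/- Let (𝒜, ℬ) be a complete cotorsion pair in an abelian category C, and let D be a full subcategory of C that is closed under extensions, contains ℬ, and is coresolving (for every short exact sequence 0 → X → Y → Z → 0 in C with X, Y ∈ D, also Z ∈ D). Then (𝒜 ∩ D, ℬ) is a complete cotorsion pair in D; concretely: (i) an object X ∈ D satisfies Ext^1(X, B) = 0 for all B ∈ ℬ if and only if X ∈ 𝒜 ∩ D; (ii) an object Y ∈ D satisfies Ext^1(X, Y) = 0 for all X ∈ 𝒜 ∩ D if and only if Y ∈ ℬ; (iii) every D ∈ D fits into short exact sequences 0 → B → A → D → 0 and 0 → D → B' → A' → 0 in C with A, A' ∈ 𝒜 ∩ D and B, B' ∈ ℬ. -/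
open CategoryTheory CategoryTheory.Limits CategoryTheory.Abelian ZeroObject

universe w' w v u

/-- If `0 → X₁ → X₂ → X₃ → 0` is short exact and `Ext¹(X₃, X₁) = 0`, then `X₁` inherits the
vanishing of `Ext¹(T, -)` from `X₂`. -/
theorem subsingleton_ext_one_of_shortExact {C : Type u} [Category.{v} C] [Abelian C]
    [HasExt.{w} C] {S : ShortComplex C} (hS : S.ShortExact)
    (h : Subsingleton (Abelian.Ext.{w} S.X₃ S.X₁ 1)) (T : C)
    (hT : Subsingleton (Abelian.Ext.{w} T S.X₂ 1)) :
    Subsingleton (Abelian.Ext.{w} T S.X₁ 1) := by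
  obtain ⟨r, hr⟩ := Ext.contravariant_sequence_exact₁ hS S.X₁ (Ext.mk₀ (𝟙 S.X₁))
    (add_zero 1) (Subsingleton.elim _ _)
  refine subsingleton_of_forall_eq 0 fun x => ?_
  rw [← Ext.comp_mk₀_id x, ← hr,
    ← Ext.comp_assoc x (Ext.mk₀ S.f) r (add_zero 1) (add_zero 0) (by simp),
    Subsingleton.elim (x.comp (Ext.mk₀ S.f) (add_zero 1)) 0, Ext.zero_comp]

/-- a complete cotorsion pair `(𝒜, ℬ)` in an abelian category `C` restricts
to a complete cotorsion pair `(𝒜 ∩ D, ℬ)` on any extension-closed coresolving full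
subcategory `D` containing `ℬ`. -/
theorem stmt15 (C : Type u) [Category.{v} C] [Abelian C] [HasExt.{w} C]
    (𝒜 ℬ : Set C) (hcp : IsCompleteCotorsionPair C 𝒜 ℬ)
    (D : Set C)
    -- `D` is closed under extensions:
    (hDext : ∀ X Y Z : C, IsShortExactSeq X Y Z → X ∈ D → Z ∈ D → Y ∈ D)
    -- `D` contains `ℬ`:
    (hBD : ℬ ⊆ D)
    -- `D` is coresolving:
    (hDcores : ∀ X Y Z : C, IsShortExactSeq X Y Z → X ∈ D → Y ∈ D → Z ∈ D) :
    -- (i)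
    (∀ X ∈ D, ((∀ B ∈ ℬ, Subsingleton (Abelian.Ext.{w} X B 1)) ↔ X ∈ 𝒜 ∩ D)) ∧
    -- (ii)
    (∀ Y ∈ D, ((∀ X ∈ 𝒜 ∩ D, Subsingleton (Abelian.Ext.{w} X Y 1)) ↔ Y ∈ ℬ)) ∧
    -- (iii)
    (∀ M ∈ D, (∃ B A, B ∈ ℬ ∧ A ∈ 𝒜 ∩ D ∧ IsShortExactSeq B A M) ∧
      (∃ B A, B ∈ ℬ ∧ A ∈ 𝒜 ∩ D ∧ IsShortExactSeq M B A)) := by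
  refine ⟨fun X hX => ⟨fun h => ⟨(hcp.mem_left_iff X).2 h, hX⟩,
      fun h => (hcp.mem_left_iff X).1 h.1⟩,
    fun Y hY => ⟨fun h => ?_, fun h X hX => (hcp.mem_right_iff Y).1 h X hX.1⟩,
    fun M hM => ⟨?_, ?_⟩⟩
  · obtain ⟨B, A, hB, hA, hS⟩ := hcp.preenvelope Y
    have hYA := h A ⟨hA, hDcores _ _ _ hS hY (hBD hB)⟩
    obtain ⟨f, g, w, hfg⟩ := hS
    exact (hcp.mem_right_iff Y).2 fun T hT =>
      subsingleton_ext_one_of_shortExact hfg hYA T ((hcp.mem_right_iff B).1 hB T hT)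
  · obtain ⟨B, A, hB, hA, hS⟩ := hcp.precover M
    exact ⟨B, A, hB, ⟨hA, hDext _ _ _ hS (hBD hB) hM⟩, hS⟩
  · obtain ⟨B, A, hB, hA, hS⟩ := hcp.preenvelope M
    exact ⟨B, A, hB, ⟨hA, hDcores _ _ _ hS hM (hBD hB)⟩, hS⟩
end

section
/- Let R be a right coherent ring and let (𝒜, ℬ) be a complete hereditary cotorsion pair in the category of right R-modules such that every module in ℬ is Fp-injective and has injective dimension at most n. Then every Fp-injective ℬ-periodic module belongs to ℬ: if M is Fp-injective and there is a short exact sequence 0 → M → B → M → 0 with B ∈ ℬ, then M ∈ ℬ. -/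
open CategoryTheory CategoryTheory.Limits CategoryTheory.Abelian ZeroObject

universe w' w v u

/-- `M` is Fp-injective: `Ext¹(X, M) = 0` for every finitely presented module `X`. -/
def IsFpInjective (R : Type u) [Ring R] [HasExt.{w} (ModuleCat.{u} Rᵐᵒᵖ)]
    (M : ModuleCat.{u} Rᵐᵒᵖ) : Prop :=
  ∀ X : ModuleCat.{u} Rᵐᵒᵖ, Module.FinitePresentation Rᵐᵒᵖ X →
    Subsingleton (Abelian.Ext.{w} X M 1)

lemma exists_shortExact_injective {C : Type u} [Category.{v} C] [Abelian C]
    [EnoughInjectives C] (N : C) :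
    ∃ (I Q : C) (f : N ⟶ I) (g : I ⟶ Q) (w : f ≫ g = 0),
      Injective I ∧ (ShortComplex.mk f g w).ShortExact :=
  ⟨Injective.under N, cokernel (Injective.ι N), Injective.ι N, cokernel.π _, cokernel.condition _,
    inferInstance, { exact := ShortComplex.exact_cokernel _ }⟩

section ExtVanishing

variable {C : Type u} [Category.{v} C] [Abelian C] [HasExt.{w} C] {X Y Z : C}

lemma IsShortExactSeq.subsingleton_ext_middle (h : IsShortExactSeq X Y Z) (N : C) (i : ℕ)
    (hX : Subsingleton (Ext.{w} X N i)) (hZ : Subsingleton (Ext.{w} Z N i)) :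
    Subsingleton (Ext.{w} Y N i) := by
  obtain ⟨f, g, w, hS⟩ := h
  refine subsingleton_of_forall_eq 0 fun e => ?_
  obtain ⟨x, rfl⟩ := Ext.contravariant_sequence_exact₂ hS N e
    (Subsingleton.elim (α := Ext X N i) _ _)
  rw [Subsingleton.elim (α := Ext Z N i) x 0, Ext.comp_zero]

lemma IsShortExactSeq.subsingleton_ext_left (h : IsShortExactSeq X Y Z) (N : C) (i : ℕ)
    (hY : Subsingleton (Ext.{w} Y N i)) (hZ : Subsingleton (Ext.{w} Z N (i + 1))) :
    Subsingleton (Ext.{w} X N i) := by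
  obtain ⟨f, g, w, hS⟩ := h
  refine subsingleton_of_forall_eq 0 fun e => ?_
  obtain ⟨x, rfl⟩ := Ext.contravariant_sequence_exact₁ hS N e (add_comm 1 i)
    (Subsingleton.elim (α := Ext Z N (i + 1)) _ _)
  rw [Subsingleton.elim (α := Ext Y N i) x 0, Ext.comp_zero]

lemma IsShortExactSeq.subsingleton_ext_right (h : IsShortExactSeq X Y Z) (N : C) (i : ℕ)
    (hX : Subsingleton (Ext.{w} X N i)) (hY : Subsingleton (Ext.{w} Y N (i + 1))) :
    Subsingleton (Ext.{w} Z N (i + 1)) := by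
  obtain ⟨f, g, w, hS⟩ := h
  refine subsingleton_of_forall_eq 0 fun e => ?_
  obtain ⟨x, rfl⟩ := Ext.contravariant_sequence_exact₃ hS N e
    (Subsingleton.elim (α := Ext Y N (i + 1)) _ _) (add_comm 1 i)
  rw [Subsingleton.elim (α := Ext X N i) x 0, Ext.comp_zero]

lemma IsShortExactSeq.subsingleton_ext_to_right (h : IsShortExactSeq X Y Z) (A : C) (i : ℕ)
    (hY : Subsingleton (Ext.{w} A Y i)) (hX : Subsingleton (Ext.{w} A X (i + 1))) :
    Subsingleton (Ext.{w} A Z i) := by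
  obtain ⟨f, g, w, hS⟩ := h
  refine subsingleton_of_forall_eq 0 fun e => ?_
  obtain ⟨x, rfl⟩ := Ext.covariant_sequence_exact₃ A hS e rfl
    (Subsingleton.elim (α := Ext A X (i + 1)) _ _)
  rw [Subsingleton.elim (α := Ext A Y i) x 0, Ext.zero_comp]

lemma IsShortExactSeq.subsingleton_ext_to_left (h : IsShortExactSeq X Y Z) (A : C) (i : ℕ)
    (hZ : Subsingleton (Ext.{w} A Z i)) (hY : Subsingleton (Ext.{w} A Y (i + 1))) :
    Subsingleton (Ext.{w} A X (i + 1)) := by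
  obtain ⟨f, g, w, hS⟩ := h
  refine subsingleton_of_forall_eq 0 fun e => ?_
  obtain ⟨x, rfl⟩ := Ext.covariant_sequence_exact₁ A hS e
    (Subsingleton.elim (α := Ext A Y (i + 1)) _ _) rfl
  rw [Subsingleton.elim (α := Ext A Z i) x 0, Ext.zero_comp]

lemma exists_lift_of_subsingleton_ext {S : ShortComplex C} (hS : S.ShortExact)
    (h : Subsingleton (Ext.{w} X S.X₁ 1)) (φ : X ⟶ S.X₃) : ∃ ψ : X ⟶ S.X₂, ψ ≫ S.g = φ := by
  obtain ⟨x, hx⟩ := Ext.covariant_sequence_exact₃ X hS (Ext.mk₀ φ) (zero_add 1)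
    (Subsingleton.elim _ _)
  obtain ⟨ψ, rfl⟩ := (Ext.mk₀_bijective X S.X₂).2 x
  exact ⟨ψ, (Ext.mk₀_bijective X S.X₃).1 (by rw [← hx, Ext.mk₀_comp_mk₀])⟩

lemma exists_extension_of_subsingleton_ext {S : ShortComplex C} (hS : S.ShortExact)
    (h : Subsingleton (Ext.{w} S.X₃ X 1)) (φ : S.X₁ ⟶ X) : ∃ ψ : S.X₂ ⟶ X, S.f ≫ ψ = φ := by
  obtain ⟨x, hx⟩ := Ext.contravariant_sequence_exact₁ hS X (Ext.mk₀ φ) (add_zero 1)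
    (Subsingleton.elim _ _)
  obtain ⟨ψ, rfl⟩ := (Ext.mk₀_bijective S.X₂ X).2 x
  exact ⟨ψ, (Ext.mk₀_bijective S.X₁ X).1 (by rw [← hx, Ext.mk₀_comp_mk₀])⟩

lemma subsingleton_ext_of_forall_lift {S : ShortComplex C} (hS : S.ShortExact) [Injective S.X₂]
    (h : ∀ φ : X ⟶ S.X₃, ∃ ψ : X ⟶ S.X₂, ψ ≫ S.g = φ) : Subsingleton (Ext.{w} X S.X₁ 1) := by
  refine subsingleton_of_forall_eq 0 fun e => ?_
  obtain ⟨x, rfl⟩ := Ext.covariant_sequence_exact₁ X hS e (Ext.eq_zero_of_injective _) (zero_add 1)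
  obtain ⟨φ, rfl⟩ := (Ext.mk₀_bijective X S.X₃).2 x
  obtain ⟨ψ, rfl⟩ := h φ
  rw [← Ext.mk₀_comp_mk₀, Ext.comp_assoc_of_second_deg_zero, hS.comp_extClass, Ext.comp_zero]

/-- Dimension shifting: an `n`-th cosyzygy `N` of `M`. -/
lemma exists_cosyzygy [EnoughInjectives C] (M : C) (n : ℕ) :
    ∃ N : C, ∀ (X : C) (i : ℕ),
      Subsingleton (Ext.{w} X N (i + 1)) ↔ Subsingleton (Ext.{w} X M (i + 1 + n)) := by
  induction n with
  | zero => exact ⟨M, fun X i => Iff.rfl⟩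
  | succ n ih =>
    obtain ⟨N, hN⟩ := ih
    obtain ⟨I, Q, f, g, w, hI, hS⟩ := exists_shortExact_injective N
    have hs : IsShortExactSeq N I Q := ⟨f, g, w, hS⟩
    refine ⟨Q, fun X i => ?_⟩
    rw [show i + 1 + (n + 1) = i + 1 + 1 + n by omega, ← hN]
    exact ⟨fun h => hs.subsingleton_ext_to_left X _ h (Ext.subsingleton_of_injective X I _),
      fun h => hs.subsingleton_ext_to_right X _ (Ext.subsingleton_of_injective X I _) h⟩

end ExtVanishing

section Modules

variable {S : Type u} [Ring S]

lemma shortExact_of_linearMap {A B D : Type u} [AddCommGroup A] [AddCommGroup B] [AddCommGroup D]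
    [Module S A] [Module S B] [Module S D] (f : A →ₗ[S] B) (g : B →ₗ[S] D)
    (hf : Function.Injective f) (hfg : Function.Exact f g) (hg : Function.Surjective g) :
    (ShortComplex.mk (ModuleCat.ofHom f) (ModuleCat.ofHom g)
      (by rw [← ModuleCat.ofHom_comp, hfg.linearMap_comp_eq_zero]; rfl)).ShortExact :=
  ModuleCat.shortComplex_shortExact _ hfg hf hg

lemma isShortExactSeq_of_linearMap {A B D : Type u} [AddCommGroup A] [AddCommGroup B]
    [AddCommGroup D] [Module S A] [Module S B] [Module S D] (f : A →ₗ[S] B) (g : B →ₗ[S] D)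
    (hf : Function.Injective f) (hfg : Function.Exact f g) (hg : Function.Surjective g) :
    IsShortExactSeq (ModuleCat.of S A) (ModuleCat.of S B) (ModuleCat.of S D) :=
  ⟨_, _, _, shortExact_of_linearMap f g hf hfg hg⟩

lemma isShortExactSeq_quotient {A : Type u} [AddCommGroup A] [Module S A] (J : Submodule S A) :
    IsShortExactSeq (ModuleCat.of S J) (ModuleCat.of S A) (ModuleCat.of S (A ⧸ J)) :=
  isShortExactSeq_of_linearMap J.subtype J.mkQ J.injective_subtype
    (LinearMap.exact_subtype_mkQ J) J.mkQ_surjective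

lemma exact_inclusion_mkQ {A : Type u} [AddCommGroup A] [Module S A] {D E : Submodule S A}
    (h : D ≤ E) : Function.Exact (Submodule.inclusion h) (D.submoduleOf E).mkQ := by
  intro x
  rw [Submodule.mkQ_apply, Submodule.Quotient.mk_eq_zero]
  exact ⟨fun hx => ⟨⟨x, hx⟩, rfl⟩, by rintro ⟨y, rfl⟩; exact y.2⟩

lemma isShortExactSeq_quotient_quotient {A : Type u} [AddCommGroup A] [Module S A]
    {D E : Submodule S A} (h : D ≤ E) :
    IsShortExactSeq (ModuleCat.of S (E ⧸ D.submoduleOf E)) (ModuleCat.of S (A ⧸ D))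
      (ModuleCat.of S (A ⧸ E)) := by
  refine isShortExactSeq_of_linearMap ((D.submoduleOf E).mapQ D E.subtype le_rfl)
    (Submodule.factor h) ?_ ?_ (Submodule.factor_surjective h)
  · rw [injective_iff_map_eq_zero]
    intro x hx
    obtain ⟨x, rfl⟩ := Submodule.mkQ_surjective _ x
    exact (Submodule.Quotient.mk_eq_zero _).2 ((Submodule.Quotient.mk_eq_zero D).1 hx)
  · intro x
    obtain ⟨x, rfl⟩ := D.mkQ_surjective x
    have hE : Submodule.factor h (D.mkQ x) = 0 ↔ x ∈ E := Submodule.Quotient.mk_eq_zero E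
    rw [hE]
    constructor
    · exact fun hx => ⟨Submodule.Quotient.mk ⟨x, hx⟩, rfl⟩
    · rintro ⟨y, hy⟩
      obtain ⟨y, rfl⟩ := Submodule.mkQ_surjective _ y
      have : (y : A) - x ∈ D := (Submodule.Quotient.eq D).1 hy
      have := E.sub_mem y.2 (h this)
      simpa using this

variable [HasExt.{w} (ModuleCat.{u} S)]

/-- A form of Eklof's lemma: partial lifts over the members of a chain of submodules glue. -/
lemma subsingleton_ext_of_filtration {A : Type u} [AddCommGroup A] [Module S A]
    (J : Submodule S A) (N : ModuleCat.{u} S) (F : Set (Submodule S A))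
    (hle : ∀ D ∈ F, D ≤ J) (hsup : ∀ c ⊆ F, sSup c ∈ F)
    (hstep : ∀ D ∈ F, D ≠ J → ∃ E ∈ F, D < E ∧
      Subsingleton (Ext.{w} (ModuleCat.of S E) N 1) ∧
      Subsingleton (Ext.{w} (ModuleCat.of S (E ⧸ D.submoduleOf E)) N 1)) :
    Subsingleton (Ext.{w} (ModuleCat.of S J) N 1) := by
  obtain ⟨I, Q, ι, g, w, hI, hS⟩ := exists_shortExact_injective N
  have hex : Function.Exact ι g :=
    (ShortComplex.ShortExact.moduleCat_exact_iff_function_exact _).1 hS.exact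
  have hinj : Function.Injective ι := (ModuleCat.mono_iff_injective ι).1 hS.mono_f
  refine subsingleton_ext_of_forall_lift hS fun φ => ?_
  let P : Set (A →ₗ.[S] I) :=
    {f | f.domain ∈ F ∧ ∀ (x : f.domain) (hx : (x : A) ∈ J), g (f x) = φ ⟨x, hx⟩}
  obtain ⟨f, hf⟩ : ∃ f, Maximal (· ∈ P) f := by
    refine zorn_le₀ P fun c hc hch => ?_
    have hd : DirectedOn (· ≤ ·) c := hch.directedOn
    refine ⟨LinearPMap.sSup c hd, ⟨?_, ?_⟩, fun z hz => LinearPMap.le_sSup hd hz⟩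
    · rw [LinearPMap.domain_sSup]
      exact hsup _ (by rintro _ ⟨z, hz, rfl⟩; exact (hc hz).1)
    · rintro ⟨x, hx⟩ hxJ
      rcases c.eq_empty_or_nonempty with rfl | hne
      · have hx0 : x = 0 := by simpa [LinearPMap.domain_sSup] using hx
        subst hx0
        exact (congrArg g (LinearPMap.map_zero (LinearPMap.sSup ∅ hd))).trans
          ((map_zero g.hom).trans (map_zero φ.hom).symm)
      · obtain ⟨z, hz, hxz⟩ := (LinearPMap.mem_domain_sSup_iff hne hd).1 hx
        have := LinearPMap.sSup_apply hd hz ⟨x, hxz⟩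
        rw [this]
        exact (hc hz).2 ⟨x, hxz⟩ hxJ
  obtain ⟨⟨hfF, hfφ⟩, hmax⟩ := hf
  by_cases hJ : f.domain = J
  · let ψ : J →ₗ[S] I := f.toFun ∘ₗ Submodule.inclusion hJ.ge
    refine ⟨ModuleCat.ofHom ψ, ?_⟩
    ext x
    exact hfφ (Submodule.inclusion hJ.ge x) x.2
  exfalso
  obtain ⟨E, hEF, hlt, hE, hED⟩ := hstep _ hfF hJ
  obtain ⟨ψ, hψ⟩ := exists_lift_of_subsingleton_ext hS hE
    (ModuleCat.ofHom (Submodule.inclusion (hle E hEF)) ≫ φ)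
  have hψ' (x : E) : g (ψ x) = φ ⟨x, hle E hEF x.2⟩ := congr($hψ x)
  let δ : f.domain →ₗ[S] I := ψ.hom ∘ₗ Submodule.inclusion hlt.le - f.toFun
  have hδ (x : f.domain) : ∃ y : N, ι y = δ x := by
    refine (hex _).1 ?_
    change g (ψ (Submodule.inclusion hlt.le x) - f x) = 0
    rw [map_sub, hψ', hfφ x (hle _ hfF x.2), sub_eq_zero]
    rfl
  choose ε hε using hδ
  let ε' : f.domain →ₗ[S] N :=
    { toFun := ε
      map_add' := fun x y => hinj (by simp [hε])
      map_smul' := fun r x => hinj (by simp [hε]) }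
  obtain ⟨η, hη⟩ := exists_extension_of_subsingleton_ext
    (shortExact_of_linearMap (Submodule.inclusion hlt.le) (f.domain.submoduleOf E).mkQ
      (Submodule.inclusion_injective _) (exact_inclusion_mkQ _) (Submodule.mkQ_surjective _))
    hED (ModuleCat.ofHom ε')
  have hη' (x : f.domain) : η (Submodule.inclusion hlt.le x) = ε x := congr($hη x)
  let f' : A →ₗ.[S] I := ⟨E, ψ.hom - ι.hom ∘ₗ η.hom⟩
  have hf'P : f' ∈ P := by
    refine ⟨hEF, fun x hx => ?_⟩
    change g (ψ x - ι (η x)) = _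
    rw [map_sub, hψ', (hex (ι (η x))).2 ⟨_, rfl⟩, sub_zero]
  have hff' : f ≤ f' := by
    refine ⟨hlt.le, fun x y hxy => ?_⟩
    obtain rfl : y = Submodule.inclusion hlt.le x := Subtype.ext hxy.symm
    change f x = ψ (Submodule.inclusion hlt.le x) - ι (η (Submodule.inclusion hlt.le x))
    rw [hη', hε]
    change f x = ψ (Submodule.inclusion hlt.le x) - (ψ (Submodule.inclusion hlt.le x) - f x)
    abel
  exact hlt.not_ge (hmax hf'P hff').1

/-- The vanishing of `Ext¹(S ⧸ J, N)` passes from finitely generated to arbitrary ideals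
when `Ext¹(-, N)` and `Ext²(-, N)` vanish simultaneously. -/
lemma subsingleton_ext_quotient_span (N : ModuleCat.{u} S)
    (hfg : ∀ J : Submodule S S, J.FG → Subsingleton (Ext.{w} (ModuleCat.of S (S ⧸ J)) N 1))
    (hper : ∀ X : ModuleCat.{u} S, Subsingleton (Ext.{w} X N 1) ↔ Subsingleton (Ext.{w} X N 2))
    (s : Set S) : Subsingleton (Ext.{w} (ModuleCat.of S (S ⧸ Submodule.span S s)) N 1) := by
  suffices H : ∀ (κ : Cardinal.{u}) (s : Set S), Cardinal.mk s = κ →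
      Subsingleton (Ext.{w} (ModuleCat.of S (S ⧸ Submodule.span S s)) N 1) from H _ s rfl
  intro κ
  induction κ using WellFoundedLT.induction with
  | ind κ ih =>
  intro s hs
  rcases s.finite_or_infinite with hfin | hinf
  · exact hfg _ ⟨hfin.toFinset, by simp⟩
  have hS (i : ℕ) : Subsingleton (Ext.{w} (ModuleCat.of S S) N (i + 1)) :=
    have : Projective (ModuleCat.of S S) :=
      ModuleCat.projective_of_free (Module.Basis.singleton Unit S)
    Ext.subsingleton_of_projective _ _ i
  have hκ : Cardinal.aleph0 ≤ κ := hs ▸ Cardinal.infinite_iff.1 hinf.to_subtype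
  obtain ⟨r, hr, hord⟩ := Cardinal.exists_ord_eq s
  have hsmall (a : s) : Cardinal.mk {b | r b a} < κ := hs ▸ Cardinal.card_typein_lt a hord
  let D (T : Set s) : Submodule S S := Submodule.span S (Subtype.val '' T)
  have hD (T : Set s) (hT : Cardinal.mk T < κ) :
      Subsingleton (Ext.{w} (ModuleCat.of S (S ⧸ D T)) N 1) :=
    ih _ hT _ (Cardinal.mk_image_eq Subtype.val_injective)
  let F : Set (Submodule S S) := {E | ∃ T : Set s, (∀ a b, r a b → b ∈ T → a ∈ T) ∧ D T = E}
  have key : Subsingleton (Ext.{w} (ModuleCat.of S (Submodule.span S s)) N 1) := by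
    refine subsingleton_ext_of_filtration _ N F ?_ ?_ ?_
    · rintro _ ⟨T, -, rfl⟩
      exact Submodule.span_mono (by rintro _ ⟨x, -, rfl⟩; exact x.2)
    · intro c hc
      refine ⟨⋃₀ {T | (∀ a b, r a b → b ∈ T → a ∈ T) ∧ D T ∈ c}, ?_, le_antisymm ?_ ?_⟩
      · rintro a b hab ⟨T, hT, hb⟩
        exact ⟨T, hT, hT.1 a b hab hb⟩
      · refine Submodule.span_le.2 ?_
        rintro _ ⟨x, ⟨T, hT, hx⟩, rfl⟩
        exact le_sSup hT.2 (Submodule.subset_span ⟨x, hx, rfl⟩)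
      · refine sSup_le fun E hE => ?_
        obtain ⟨T, hT, rfl⟩ := hc hE
        exact Submodule.span_mono (Set.image_mono (Set.subset_sUnion_of_mem ⟨hT, hE⟩))
    · rintro _ ⟨T, hT, rfl⟩ hne
      have hex : {a : s | (a : S) ∉ D T}.Nonempty := by
        by_contra hemp
        rw [Set.not_nonempty_iff_eq_empty, Set.eq_empty_iff_forall_notMem] at hemp
        refine hne (le_antisymm ?_ (Submodule.span_le.2 fun a ha => ?_))
        · exact Submodule.span_mono (by rintro _ ⟨x, -, rfl⟩; exact x.2)
        · simpa using hemp ⟨a, ha⟩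
      have hwf : WellFounded r := hr.wf
      let a := hwf.min _ hex
      have ha : (a : S) ∉ D T := hwf.min_mem _ hex
      have hmin (b : s) (hb : r b a) : (b : S) ∈ D T := by
        by_contra h
        exact hwf.not_lt_min _ h hb
      have hTa : T ⊆ {b | r b a} := by
        intro b hb
        rcases trichotomous_of r b a with h | h | h
        · exact h
        · exact (ha (Submodule.subset_span ⟨a, h ▸ hb, rfl⟩)).elim
        · exact (ha (Submodule.subset_span ⟨a, hT _ _ h hb, rfl⟩)).elim
      have hDlt : D T < D (insert a {b | r b a}) := by
        refine lt_of_le_not_ge (Submodule.span_mono (Set.image_mono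
          (hTa.trans (Set.subset_insert _ _)))) fun h => ha (h (Submodule.subset_span ?_))
        exact ⟨a, Set.mem_insert _ _, rfl⟩
      have h1 := hD T ((Cardinal.mk_le_mk_of_subset hTa).trans_lt (hsmall a))
      have h2 := hD (insert a {b | r b a}) (Cardinal.mk_insert_le.trans_lt
        (Cardinal.add_lt_of_lt hκ (hsmall a) (Cardinal.one_lt_aleph0.trans_le hκ)))
      refine ⟨_, ⟨insert a {b | r b a}, ?_, rfl⟩, hDlt, ?_, ?_⟩
      · rintro b c hbc (rfl | hc)
        · exact Or.inr hbc
        · exact Or.inr (trans_of r hbc hc)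
      · exact (isShortExactSeq_quotient _).subsingleton_ext_left N 1 (hS 0) ((hper _).1 h2)
      · exact (isShortExactSeq_quotient_quotient hDlt.le).subsingleton_ext_left N 1 h1
          ((hper _).1 h2)
  exact (hper _).2 ((isShortExactSeq_quotient _).subsingleton_ext_right N 1 key (hS 1))

lemma injective_of_subsingleton_ext_quotient (N : ModuleCat.{u} S)
    (h : ∀ J : Submodule S S, Subsingleton (Ext.{w} (ModuleCat.of S (S ⧸ J)) N 1)) :
    Injective N := by
  have hB : Module.Baer S N := fun J φ => by
    obtain ⟨ψ, hψ⟩ := exists_extension_of_subsingleton_ext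
      (shortExact_of_linearMap J.subtype J.mkQ J.injective_subtype
        (LinearMap.exact_subtype_mkQ J) J.mkQ_surjective) (h J) (ModuleCat.ofHom φ)
    exact ⟨ψ.hom, fun x hx => congr($hψ (⟨x, hx⟩ : J))⟩
  exact (Module.injective_iff_injective_object S N).1 hB.injective

/-- Over a coherent ring, the higher `Ext` groups of cyclic finitely presented modules
vanish as soon as the first ones do. -/
lemma subsingleton_ext_quotient_of_coherent
    (hcoh : ∀ J : Submodule S S, J.FG → Module.FinitePresentation S J) (M : ModuleCat.{u} S)
    (hM : ∀ J : Submodule S S, J.FG → Subsingleton (Ext.{w} (ModuleCat.of S (S ⧸ J)) M 1))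
    (i : ℕ) (J : Submodule S S) (hJ : J.FG) :
    Subsingleton (Ext.{w} (ModuleCat.of S (S ⧸ J)) M (i + 1)) := by
  induction i generalizing J with
  | zero => exact hM J hJ
  | succ i ih =>
    have : Projective (ModuleCat.of S S) :=
      ModuleCat.projective_of_free (Module.Basis.singleton Unit S)
    refine (isShortExactSeq_quotient J).subsingleton_ext_right M (i + 1) ?_
      (Ext.subsingleton_of_projective _ _ _)
    obtain ⟨t, rfl⟩ := hJ
    classical
    induction t using Finset.induction_on with
    | empty =>
      have : Subsingleton (Submodule.span S ((∅ : Finset S) : Set S)) := by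
        rw [Finset.coe_empty, Submodule.span_empty]; infer_instance
      have : Projective (ModuleCat.of S (Submodule.span S ((∅ : Finset S) : Set S))) :=
        (ModuleCat.isZero_of_subsingleton _).projective
      exact Ext.subsingleton_of_projective _ _ _
    | insert a t _ iht =>
      set D := Submodule.span S (t : Set S)
      set E := Submodule.span S ((insert a t : Finset S) : Set S) with hE
      have hDE : D ≤ E := Submodule.span_mono (by simp)
      have haE : a ∈ E := Submodule.subset_span (by simp)
      let l : S →ₗ[S] E ⧸ D.submoduleOf E :=
        (D.submoduleOf E).mkQ ∘ₗ LinearMap.toSpanSingleton S E ⟨a, haE⟩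
      have hl : Function.Surjective l := by
        intro y
        obtain ⟨⟨y, hy⟩, rfl⟩ := Submodule.mkQ_surjective _ y
        have hy' := hy
        rw [hE, Finset.coe_insert, Submodule.mem_span_insert] at hy'
        obtain ⟨r, z, hz, rfl⟩ := hy'
        refine ⟨r, ((Submodule.Quotient.eq _).2 ?_)⟩
        change r • a - (r • a + z) ∈ D
        simpa using hz
      have := hcoh E ⟨_, rfl⟩
      have hfgD : (D.submoduleOf E).FG := by
        rw [show D.submoduleOf E = _ from (Submodule.range_inclusion D E hDE).symm]
        have : Module.Finite S D := Module.Finite.iff_fg.2 ⟨t, rfl⟩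
        exact Module.Finite.iff_fg.1 inferInstance
      have : Module.FinitePresentation S (E ⧸ D.submoduleOf E) :=
        Module.finitePresentation_of_surjective (D.submoduleOf E).mkQ
          (Submodule.mkQ_surjective _) (by rwa [Submodule.ker_mkQ])
      have hker := Module.FinitePresentation.fg_ker l hl
      let e := (LinearMap.quotKerEquivOfSurjective l hl).symm
      have hs : IsShortExactSeq (ModuleCat.of S D) (ModuleCat.of S E)
          (ModuleCat.of S (S ⧸ LinearMap.ker l)) := by
        refine isShortExactSeq_of_linearMap (Submodule.inclusion hDE)
          (e.toLinearMap ∘ₗ (D.submoduleOf E).mkQ) (Submodule.inclusion_injective _) ?_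
          (e.surjective.comp (Submodule.mkQ_surjective _))
        intro x
        rw [← exact_inclusion_mkQ hDE x]
        exact e.map_eq_zero_iff
      exact hs.subsingleton_ext_middle M (i + 1) iht (ih _ hker)

end Modules

lemma finitePresentation_mulOpposite (R : Type u) [Ring R]
    (hcoh : ∀ I : Submodule Rᵐᵒᵖ R, I.FG → Module.FinitePresentation Rᵐᵒᵖ I)
    (J : Submodule Rᵐᵒᵖ Rᵐᵒᵖ) (hJ : J.FG) : Module.FinitePresentation Rᵐᵒᵖ J := by
  let e : Rᵐᵒᵖ ≃ₗ[Rᵐᵒᵖ] R :=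
    { MulOpposite.opAddEquiv.symm with map_smul' := fun r x => rfl }
  have := hcoh (J.map e.toLinearMap) (hJ.map _)
  exact Module.FinitePresentation.of_equiv (e.submoduleMap J).symm

/-- over a right coherent ring, for a complete hereditary cotorsion pair
`(𝒜, ℬ)` with `ℬ` consisting of Fp-injective modules of injective dimension at most `n`,
every Fp-injective `ℬ`-periodic module belongs to `ℬ`.
Right `R`-modules are modules over `Rᵐᵒᵖ`. -/
theorem stmt18 (R : Type u) [Ring R] [HasExt.{w} (ModuleCat.{u} Rᵐᵒᵖ)]
    -- `R` is right coherent: every finitely generated right ideal is finitely presented: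
    (hcoh : ∀ I : Submodule Rᵐᵒᵖ R, I.FG → Module.FinitePresentation Rᵐᵒᵖ I)
    (𝒜 ℬ : Set (ModuleCat.{u} Rᵐᵒᵖ))
    (hcp : IsCompleteHereditaryCotorsionPair (ModuleCat.{u} Rᵐᵒᵖ) 𝒜 ℬ)
    (n : ℕ)
    -- every module in `ℬ` is Fp-injective:
    (hfp : ∀ B ∈ ℬ, IsFpInjective R B)
    -- every module in `ℬ` has injective dimension at most `n`:
    (hid : ∀ B ∈ ℬ, ∀ (M : ModuleCat.{u} Rᵐᵒᵖ) (i : ℕ), n < i →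
      Subsingleton (Abelian.Ext.{w} M B i))
    (M : ModuleCat.{u} Rᵐᵒᵖ) (hM : IsFpInjective R M)
    (B : ModuleCat.{u} Rᵐᵒᵖ) (hB : B ∈ ℬ)
    -- `0 → M → B → M → 0` is exact:
    (hper : IsShortExactSeq M B M) :
    M ∈ ℬ := by
  obtain ⟨N, hN⟩ := exists_cosyzygy.{w} M n
  have hfg (i : ℕ) (J : Submodule Rᵐᵒᵖ Rᵐᵒᵖ) (hJ : J.FG) :
      Subsingleton (Ext.{w} (ModuleCat.of Rᵐᵒᵖ (Rᵐᵒᵖ ⧸ J)) M (i + 1)) :=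
    subsingleton_ext_quotient_of_coherent (finitePresentation_mulOpposite R hcoh) M
      (fun J hJ => hM _ (Module.finitePresentation_of_surjective J.mkQ J.mkQ_surjective
        (by rwa [Submodule.ker_mkQ]))) i J hJ
  have hperN (X : ModuleCat.{u} Rᵐᵒᵖ) :
      Subsingleton (Ext.{w} X N 1) ↔ Subsingleton (Ext.{w} X N 2) := by
    rw [hN X 0, hN X 1, show 1 + 1 + n = 0 + 1 + n + 1 by omega]
    exact ⟨fun h => hper.subsingleton_ext_to_left X _ h (hid B hB X _ (by omega)),
      fun h => hper.subsingleton_ext_to_right X _ (hid B hB X _ (by omega)) h⟩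
  have hNinj : Injective N := injective_of_subsingleton_ext_quotient N fun J => by
    rw [← Submodule.span_eq J]
    refine subsingleton_ext_quotient_span N (fun J hJ => (hN _ 0).2 ?_) hperN _
    rw [show 0 + 1 + n = n + 1 by omega]
    exact hfg n J hJ
  refine (hcp.mem_right_iff M).2 fun A hA => ?_
  have hdesc (k : ℕ) (h : Subsingleton (Ext.{w} A M (1 + k))) : Subsingleton (Ext.{w} A M 1) := by
    induction k with
    | zero => exact h
    | succ k ih =>
      exact ih (hper.subsingleton_ext_to_right A (1 + k)
        (hcp.hereditary A hA B hB _ (by omega)) h)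
  exact hdesc n ((hN A 0).1 (Ext.subsingleton_of_injective A N 0))
end

section
/- Let R be a ring and let (𝒜, ℬ) be a complete hereditary cotorsion pair in the category of right R-modules such that every module in 𝒜 is flat and has projective dimension at most n. Then every flat 𝒜-periodic module belongs to 𝒜: if M is flat and there is a short exact sequence 0 → M → A → M → 0 with A ∈ 𝒜, then M ∈ 𝒜. -/
open CategoryTheory CategoryTheory.Limits CategoryTheory.Abelian ZeroObject

universe w' w v u

/-- `F` is a colimit of a filtered diagram of shape `J` of finitely generated free modules. -/
def IsFlatAux (R : Type u) [Ring R] (M : ModuleCat.{u} Rᵐᵒᵖ) (J : Type u)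
    [hJ : SmallCategory J] : Prop :=
  IsFiltered J ∧ ∃ (D : J ⥤ ModuleCat.{u} Rᵐᵒᵖ) (c : Cocone D),
    (∀ j : J, Module.Finite Rᵐᵒᵖ (D.obj j) ∧ Module.Free Rᵐᵒᵖ (D.obj j)) ∧
    Nonempty (IsColimit c) ∧ Nonempty (c.pt ≅ M)

/-- `M` is a flat module: by Lazard's theorem, a module (over an arbitrary,
not necessarily commutative, ring) is flat if and only if it is a filtered colimit of
finitely generated free modules, which we use as the definition here. -/
def IsFlatModule (R : Type u) [Ring R] (M : ModuleCat.{u} Rᵐᵒᵖ) : Prop :=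
  ∃ (J : Type u) (hJ : SmallCategory J), IsFlatAux R M J (hJ := hJ)

section PureAcyclic

variable {R : Type u} [Ring R]

lemma LinearMap.congr_of_support_subset {X : Type*} {N : Type*} [AddCommGroup N] [Module R N]
    {F G : (X →₀ R) →ₗ[R] N} {t : Finset X} {v : X →₀ R} (hv : v.support ⊆ t)
    (h : ∀ x ∈ t, F (Finsupp.single x 1) = G (Finsupp.single x 1)) : F v = G v := by
  have key : ∀ H : (X →₀ R) →ₗ[R] N, H v = v.sum fun x a ↦ a • H (Finsupp.single x 1) := by
    intro H
    conv_lhs => rw [← Finsupp.sum_single v, map_finsuppSum]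
    exact Finsupp.sum_congr fun x _ ↦ by rw [← map_smul, Finsupp.smul_single_one]
  rw [key F, key G]
  exact Finsupp.sum_congr fun x hx ↦ by rw [h x (hv hx)]

/-- The homotopy on `P` prescribed on generators by `τ`, via the embedding `i` into a free
module. -/
noncomputable def homotopyOf {P : Type v} [AddCommGroup P] [Module R P] (i : P →ₗ[R] P →₀ R)
    (τ : P → P) : P →ₗ[R] P :=
  Finsupp.linearCombination R τ ∘ₗ i

lemma homotopyOf_congr {P : Type v} [AddCommGroup P] [Module R P] (i : P →ₗ[R] P →₀ R)
    {τ τ' : P → P} {x : P} (h : ∀ y ∈ (i x).support, τ y = τ' y) :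
    homotopyOf i τ x = homotopyOf i τ' x :=
  LinearMap.congr_of_support_subset (F := Finsupp.linearCombination R τ)
    (G := Finsupp.linearCombination R τ') subset_rfl fun y hy ↦ by simp [h y hy]

/-- The null-homotopic endomorphism `dσ + σd`. -/
def nullHomotopic {P : Type v} [AddCommGroup P] [Module R P] (d σ : P →ₗ[R] P) : P →ₗ[R] P :=
  d ∘ₗ σ + σ ∘ₗ d

section Contraction

variable {P : Type v} [AddCommGroup P] [Module R P] {d : P →ₗ[R] P}

lemma nullHomotopic_apply (σ : P →ₗ[R] P) (x : P) :
    nullHomotopic d σ x = d (σ x) + σ (d x) := rfl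

lemma nullHomotopic_comm (hd : ∀ x, d (d x) = 0) (σ : P →ₗ[R] P) (x : P) :
    nullHomotopic d σ (d x) = d (nullHomotopic d σ x) := by
  simp [nullHomotopic_apply, hd]

lemma exists_extend_homotopy (hd : ∀ x, d (d x) = 0)
    (hloc : ∀ s : Finset P, ∃ σ : P →ₗ[R] P, ∀ x ∈ s, nullHomotopic d σ x = x)
    {i : P →ₗ[R] P →₀ R} (hi : ∀ x, Finsupp.linearCombination R id (i x) = x)
    (τ : P → P) (s : Finset P) :
    ∃ τ' : P → P,
      (∀ x, nullHomotopic d (homotopyOf i τ) x = x → τ' x = τ x) ∧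
      (∀ x, nullHomotopic d (homotopyOf i τ) x = x →
        nullHomotopic d (homotopyOf i τ') x = x) ∧
      ∀ x ∈ s, nullHomotopic d (homotopyOf i τ') x = x := by
  classical
  set U := nullHomotopic d (homotopyOf i τ) with hU
  obtain ⟨σ, hσ⟩ := hloc (s.image fun x ↦ x - U x)
  let τ' : P → P := fun x ↦ τ x + σ (x - U x)
  have key : ∀ x, homotopyOf i τ' x = homotopyOf i τ x + σ (x - U x) := by
    intro x
    have h1 : ∀ v : P →₀ R, Finsupp.linearCombination R τ' v =
        Finsupp.linearCombination R τ v +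
          (σ ∘ₗ (LinearMap.id - U)) (Finsupp.linearCombination R id v) :=
      fun v ↦ LinearMap.congr_of_support_subset
        (G := Finsupp.linearCombination R τ +
          (σ ∘ₗ (LinearMap.id - U)) ∘ₗ Finsupp.linearCombination R id)
        subset_rfl fun y _ ↦ by simp [τ']
    simp [homotopyOf, h1, hi]
  have key' : ∀ x, nullHomotopic d (homotopyOf i τ') x =
      U x + nullHomotopic d σ (x - U x) := by
    intro x
    have h2 : d x - U (d x) = d (x - U x) := by rw [map_sub, hU, nullHomotopic_comm hd]
    rw [nullHomotopic_apply, key, key, h2, nullHomotopic_apply σ, map_add]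
    have : U x = d (homotopyOf i τ x) + homotopyOf i τ (d x) := rfl
    rw [this]; abel
  refine ⟨τ', fun x hx ↦ ?_, fun x hx ↦ ?_, fun x hx ↦ ?_⟩
  · simp [τ', hx]
  · rw [key', hx, sub_self, map_zero, add_zero]
  · rw [key', hσ _ (Finset.mem_image_of_mem _ hx)]; abel

/-- A set of generators together with a homotopy contracting the subcomplex they span. -/
structure PartialContraction (d : P →ₗ[R] P) (i : P →ₗ[R] P →₀ R) where
  /-- the generators -/
  carrier : Set P
  /-- the homotopy on generators -/
  toFun : P → P
  closed : ∀ x ∈ carrier, ∀ y, y ∈ (i x).support ∨ y ∈ (i (d x)).support → y ∈ carrier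
  contracts : ∀ x ∈ carrier, nullHomotopic d (homotopyOf i toFun) x = x

/-- One partial contraction extends another. -/
def PartialContraction.Extends {i : P →ₗ[R] P →₀ R} (p q : PartialContraction d i) : Prop :=
  p.carrier ⊆ q.carrier ∧ ∀ x ∈ p.carrier, p.toFun x = q.toFun x

lemma nullHomotopic_homotopyOf_congr {i : P →ₗ[R] P →₀ R} {τ τ' : P → P} {x : P}
    (h : ∀ y, y ∈ (i x).support ∨ y ∈ (i (d x)).support → τ y = τ' y) :
    nullHomotopic d (homotopyOf i τ) x = nullHomotopic d (homotopyOf i τ') x := by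
  rw [nullHomotopic_apply, nullHomotopic_apply, homotopyOf_congr i fun y hy ↦ h y (.inl hy),
    homotopyOf_congr i fun y hy ↦ h y (.inr hy)]

lemma PartialContraction.exists_upperBound {i : P →ₗ[R] P →₀ R}
    (c : Set (PartialContraction d i)) (hc : IsChain PartialContraction.Extends c) :
    ∃ q, ∀ p ∈ c, p.Extends q := by
  classical
  let S : Set P := {x | ∃ p ∈ c, x ∈ p.carrier}
  let τ : P → P := fun x ↦ if h : ∃ p ∈ c, x ∈ p.carrier then h.choose.toFun x else 0
  have hτ : ∀ p ∈ c, ∀ x ∈ p.carrier, p.toFun x = τ x := by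
    intro p hp x hx
    have h : ∃ p ∈ c, x ∈ p.carrier := ⟨p, hp, hx⟩
    simp only [τ, dif_pos h]
    by_cases hpq : p = h.choose
    · rw [← hpq]
    · rcases hc hp h.choose_spec.1 hpq with h1 | h1
      · exact h1.2 x hx
      · exact (h1.2 x h.choose_spec.2).symm
  refine ⟨⟨S, τ, ?_, ?_⟩, fun p hp ↦ ⟨fun x hx ↦ ⟨p, hp, hx⟩, hτ p hp⟩⟩
  · rintro x ⟨p, hp, hx⟩ y hy
    exact ⟨p, hp, p.closed x hx y hy⟩
  · rintro x ⟨p, hp, hx⟩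
    rw [← nullHomotopic_homotopyOf_congr fun y hy ↦ hτ p hp y (p.closed x hx y hy)]
    exact p.contracts x hx

lemma PartialContraction.exists_extends_mem (hd : ∀ x, d (d x) = 0)
    (hloc : ∀ s : Finset P, ∃ σ : P →ₗ[R] P, ∀ x ∈ s, nullHomotopic d σ x = x)
    {i : P →ₗ[R] P →₀ R} (hi : ∀ x, Finsupp.linearCombination R id (i x) = x)
    (p : PartialContraction d i) (x : P) :
    ∃ q, p.Extends q ∧ x ∈ q.carrier := by
  classical
  choose next hnext₁ hnext₂ hnext₃ using exists_extend_homotopy hd hloc hi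
  obtain ⟨Y, hY₀, hY⟩ : ∃ Y : ℕ → Finset P, x ∈ Y 0 ∧
      ∀ n, Y (n + 1) = (Y n).biUnion fun y ↦ (i y).support ∪ (i (d y)).support :=
    ⟨fun n ↦ Nat.rec {x} (fun _ Z ↦ Z.biUnion fun y ↦ (i y).support ∪ (i (d y)).support) n,
      Finset.mem_singleton_self x, fun _ ↦ rfl⟩
  obtain ⟨τ, hτ₀, hτ⟩ : ∃ τ : ℕ → P → P, τ 0 = p.toFun ∧ ∀ n, τ (n + 1) = next (τ n) (Y n) :=
    ⟨fun n ↦ Nat.rec p.toFun (fun k t ↦ next t (Y k)) n, rfl, fun _ ↦ rfl⟩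
  let A : ℕ → Set P := fun n ↦ {y | nullHomotopic d (homotopyOf i (τ n)) y = y}
  have hA : Monotone A := monotone_nat_of_le_succ fun n y hy ↦ by
    simpa only [A, Set.mem_ofPred_eq, hτ] using hnext₂ (τ n) (Y n) y hy
  have hYA : ∀ n, ∀ y ∈ Y n, y ∈ A (n + 1) := fun n y hy ↦ by
    simpa only [A, Set.mem_ofPred_eq, hτ] using hnext₃ (τ n) (Y n) y hy
  have hstable : ∀ n m, n ≤ m → ∀ y ∈ A n, τ m y = τ n y := by
    intro n m hnm y hy
    induction m, hnm using Nat.le_induction with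
    | base => rfl
    | succ m hm ih => rw [hτ, hnext₁ (τ m) (Y m) y (hA hm hy), ih]
  let τ' : P → P := fun y ↦ if h : ∃ n, y ∈ A n then τ h.choose y else 0
  have hτ' : ∀ n, ∀ y ∈ A n, τ n y = τ' y := by
    intro n y hy
    have h : ∃ n, y ∈ A n := ⟨n, hy⟩
    simp only [τ', dif_pos h]
    rcases le_total n h.choose with h1 | h1
    · exact (hstable _ _ h1 y hy).symm
    · exact hstable _ _ h1 y h.choose_spec
  have hpA : ∀ y ∈ p.carrier, y ∈ A 0 := fun y hy ↦ by
    simpa only [A, Set.mem_ofPred_eq, hτ₀] using p.contracts y hy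
  have hYY : ∀ n, ∀ y ∈ Y n, ∀ z, z ∈ (i y).support ∨ z ∈ (i (d y)).support →
      z ∈ Y (n + 1) := fun n y hy z hz ↦ by
    rw [hY]
    exact Finset.mem_biUnion.2 ⟨y, hy, Finset.mem_union.2 hz⟩
  have hx : x ∈ p.carrier ∪ {y | ∃ n, y ∈ Y n} :=
    Or.inr ⟨0, hY₀⟩
  refine ⟨⟨p.carrier ∪ {y | ∃ n, y ∈ Y n}, τ', ?_, ?_⟩,
    ⟨Set.subset_union_left, fun y hy ↦ hτ₀ ▸ hτ' 0 y (hpA y hy)⟩, hx⟩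
  · rintro y (hy | hy) z hz
    · exact Or.inl (p.closed y hy z hz)
    · obtain ⟨n, hn⟩ := hy
      exact Or.inr ⟨n + 1, hYY n y hn z hz⟩
  · rintro y (hy | hy)
    · rw [← nullHomotopic_homotopyOf_congr fun z hz ↦ hτ' 0 z (hpA z (p.closed y hy z hz))]
      exact hpA y hy
    · obtain ⟨n, hn⟩ := hy
      rw [← nullHomotopic_homotopyOf_congr fun z hz ↦
        hτ' (n + 2) z (hYA (n + 1) z (hYY n y hn z hz))]
      exact hA (Nat.le_succ _) (hYA n y hn)

/-- A differential on a projective module which is locally contractible is contractible. -/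
theorem exists_contraction_of_locally [Module.Projective R P] (hd : ∀ x, d (d x) = 0)
    (hloc : ∀ s : Finset P, ∃ σ : P →ₗ[R] P, ∀ x ∈ s, nullHomotopic d σ x = x) :
    ∃ σ : P →ₗ[R] P, ∀ x, nullHomotopic d σ x = x := by
  obtain ⟨i, hi⟩ := (Module.projective_def (R := R) (P := P)).1 inferInstance
  obtain ⟨p, hp⟩ := exists_maximal_of_chains_bounded
    (PartialContraction.exists_upperBound (d := d) (i := i))
    fun {p q r} h₁ h₂ ↦
      ⟨h₁.1.trans h₂.1, fun x hx ↦ (h₁.2 x hx).trans (h₂.2 x (h₁.1 hx))⟩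
  refine ⟨homotopyOf i p.toFun, fun x ↦ p.contracts x ?_⟩
  obtain ⟨q, hpq, hx⟩ := p.exists_extends_mem hd hloc hi x
  exact (hp q hpq).1 hx

end Contraction

/-- Every relation in `M` between finitely many elements is explained by a projective module:
this holds for filtered colimits of finitely generated free modules. -/
def FactorsLocally (R : Type u) [Ring R] (M : Type v) [AddCommGroup M] [Module R M] : Prop :=
  ∀ (X : Type v) (φ : (X →₀ R) →ₗ[R] M) (t : Finset X) (s : Finset (X →₀ R)),
    (∀ v ∈ s, φ v = 0 ∧ v.support ⊆ t) →
    ∃ (G : Type v) (_ : AddCommGroup G) (_ : Module R G) (θ : (X →₀ R) →ₗ[R] G)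
      (ψ : G →ₗ[R] M), Module.Projective R G ∧ (∀ v ∈ s, θ v = 0) ∧
      ∀ x ∈ t, ψ (θ (Finsupp.single x 1)) = φ (Finsupp.single x 1)

section LocalSplitting

variable {K Q M : Type v} [AddCommGroup K] [AddCommGroup Q] [AddCommGroup M]
  [Module R K] [Module R Q] [Module R M] {f : K →ₗ[R] Q} {g : Q →ₗ[R] M}

/-- A short exact sequence with projective middle term and flat cokernel splits locally. -/
lemma FactorsLocally.exists_local_retraction (hM : FactorsLocally R M) [Module.Projective R Q]
    (hf : Function.Injective f) (hg : Function.Surjective g) (hfg : Function.Exact f g)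
    (s : Finset K) : ∃ ρ : Q →ₗ[R] K, ∀ k ∈ s, ρ (f k) = k := by
  classical
  obtain ⟨i, hi⟩ := (Module.projective_def (R := R) (P := Q)).1 inferInstance
  let r : (Q →₀ R) →ₗ[R] Q := Finsupp.linearCombination R id
  let t : Finset Q := s.biUnion fun k ↦ (i (f k)).support
  obtain ⟨G, _, _, θ, ψ, hG, hθ, hψ⟩ := hM Q (g ∘ₗ r) t (s.image fun k ↦ i (f k)) (by
    intro v hv
    obtain ⟨k, hk, rfl⟩ := Finset.mem_image.1 hv
    refine ⟨?_, Finset.subset_biUnion_of_mem (fun k ↦ (i (f k)).support) hk⟩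
    rw [LinearMap.comp_apply, hi (f k)]
    exact hfg.apply_apply_eq_zero k)
  obtain ⟨ψ', hψ'⟩ := Module.projective_lifting_property g ψ hg
  have hex : ∀ x : Q, ∃ k : K, x ∈ t → f k = x - ψ' (θ (Finsupp.single x 1)) := by
    intro x
    by_cases hx : x ∈ t
    · obtain ⟨k, hk⟩ := (hfg (x - ψ' (θ (Finsupp.single x 1)))).1 (by
        have := hψ x hx
        rw [← hψ'] at this
        simp only [LinearMap.comp_apply] at this
        rw [map_sub, this]
        simp [r])
      exact ⟨k, fun _ ↦ hk⟩
    · exact ⟨0, fun h ↦ absurd h hx⟩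
  choose κ hκ using hex
  have hsum : ∀ v : Q →₀ R, v.support ⊆ t →
      f (Finsupp.linearCombination R κ v) = r v - ψ' (θ v) := by
    intro v hv
    exact LinearMap.congr_of_support_subset (F := f ∘ₗ Finsupp.linearCombination R κ)
      (G := r - ψ' ∘ₗ θ) hv fun x hx ↦ by simp [hκ x hx, r]
  refine ⟨Finsupp.linearCombination R κ ∘ₗ i, fun k hk ↦ hf ?_⟩
  rw [LinearMap.comp_apply, hsum _ (Finset.subset_biUnion_of_mem
    (fun k ↦ (i (f k)).support) hk), hθ _ (Finset.mem_image_of_mem _ hk), map_zero, sub_zero]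
  exact hi (f k)

/-- Syzygies of flat modules are flat. -/
lemma FactorsLocally.of_exact (hM : FactorsLocally R M) [Module.Projective R Q]
    (hf : Function.Injective f) (hg : Function.Surjective g) (hfg : Function.Exact f g) :
    FactorsLocally R K := by
  classical
  intro X φ t s hs
  obtain ⟨ρ, hρ⟩ := hM.exists_local_retraction hf hg hfg
    (t.image fun x ↦ φ (Finsupp.single x 1))
  refine ⟨Q, inferInstance, inferInstance, f ∘ₗ φ, ρ, inferInstance, fun v hv ↦ ?_,
    fun x hx ↦ hρ _ (Finset.mem_image_of_mem _ hx)⟩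
  simp [(hs v hv).1]

end LocalSplitting

section Periodic

variable {M P : Type v} [AddCommGroup M] [AddCommGroup P] [Module R M] [Module R P]
  {f : M →ₗ[R] P} {g : P →ₗ[R] M}

lemma FactorsLocally.exists_local_contraction (hM : FactorsLocally R M) [Module.Projective R P]
    (hf : Function.Injective f) (hg : Function.Surjective g) (hfg : Function.Exact f g)
    (s : Finset P) : ∃ σ : P →ₗ[R] P, ∀ x ∈ s, nullHomotopic (f ∘ₗ g) σ x = x := by
  classical
  set d := f ∘ₗ g
  have hd : ∀ x, d (d x) = 0 := fun x ↦ by simp [d, hfg.apply_apply_eq_zero]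
  have hker : ∀ x, d x = 0 → ∃ y, d y = x := by
    intro x hx
    obtain ⟨m, rfl⟩ := (hfg x).1 (hf (hx.trans (map_zero f).symm))
    obtain ⟨y, rfl⟩ := hg m
    exact ⟨y, rfl⟩
  have hsplit : ∀ t : Finset P, ∃ h : P →ₗ[R] P, ∀ y ∈ t, d (h (d y)) = d y := by
    intro t
    obtain ⟨ρ, hρ⟩ := hM.exists_local_retraction hf hg hfg (t.image g)
    obtain ⟨h, hh⟩ := Module.projective_lifting_property g ρ hg
    refine ⟨h, fun y hy ↦ ?_⟩
    have h1 : g (h (d y)) = ρ (d y) := LinearMap.congr_fun hh (d y)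
    change f (g (h (d y))) = f (g y)
    rw [h1]
    exact congrArg f (hρ (g y) (Finset.mem_image_of_mem _ hy))
  obtain ⟨h₂, hh₂⟩ := hsplit s
  obtain ⟨i, hi⟩ := (Module.projective_def (R := R) (P := P)).1 inferInstance
  let V₂ : P →ₗ[R] P := LinearMap.id - nullHomotopic d h₂
  let t : Finset P := s.biUnion fun x ↦ (i (V₂ x)).support
  obtain ⟨h, hh⟩ := hsplit t
  let V : P →ₗ[R] P := LinearMap.id - nullHomotopic d h
  have hV₂ : ∀ x ∈ s, V₂ (d x) = 0 := fun x hx ↦ by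
    simp [V₂, nullHomotopic_apply, hd, hh₂ x hx]
  have hV : ∀ y ∈ t, d (V y) = 0 := fun y hy ↦ by
    simp [V, nullHomotopic_apply, hd, hh y hy]
  have hex : ∀ y, ∃ z, y ∈ t → d z = V y := by
    intro y
    by_cases hy : y ∈ t
    · obtain ⟨z, hz⟩ := hker _ (hV y hy)
      exact ⟨z, fun _ ↦ hz⟩
    · exact ⟨0, fun h ↦ absurd h hy⟩
  choose κ hκ using hex
  have hκV : ∀ x ∈ s, d (homotopyOf i κ (V₂ x)) = V (V₂ x) := by
    intro x hx
    conv_rhs => rw [← hi (V₂ x)]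
    exact LinearMap.congr_of_support_subset (F := d ∘ₗ Finsupp.linearCombination R κ)
      (G := V ∘ₗ Finsupp.linearCombination R id)
      (Finset.subset_biUnion_of_mem (fun x ↦ (i (V₂ x)).support) hx)
      fun y hy ↦ by simp [hκ y hy]
  refine ⟨h + h₂ - h ∘ₗ nullHomotopic d h₂ + homotopyOf i κ ∘ₗ V₂, fun x hx ↦ ?_⟩
  have h1 := hκV x hx
  have h2 : V (V₂ x) = V₂ x - (d (h (V₂ x)) + h (d (V₂ x))) := rfl
  have h3 : V₂ x = x - nullHomotopic d h₂ x := rfl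
  have h4 := nullHomotopic_comm hd h₂ x
  have h5 : nullHomotopic d h₂ x = d (h₂ x) + h₂ (d x) := rfl
  rw [nullHomotopic_apply]
  simp only [LinearMap.add_apply, LinearMap.sub_apply, LinearMap.comp_apply, map_add, map_sub,
    hV₂ x hx, map_zero, h1, h4]
  rw [h2, h3]
  simp only [map_sub]
  rw [h5]
  abel

/-- A flat module which is periodic with respect to projective modules is projective. -/
theorem FactorsLocally.projective_of_periodic (hM : FactorsLocally R M) [Module.Projective R P]
    (hf : Function.Injective f) (hg : Function.Surjective g) (hfg : Function.Exact f g) :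
    Module.Projective R M := by
  obtain ⟨σ, hσ⟩ := exists_contraction_of_locally (d := f ∘ₗ g)
    (fun x ↦ by simp [hfg.apply_apply_eq_zero]) (hM.exists_local_contraction hf hg hfg)
  refine Module.Projective.of_split (σ ∘ₗ f) g (LinearMap.ext fun m ↦ hf ?_)
  have := hσ (f m)
  simpa [nullHomotopic_apply, hfg.apply_apply_eq_zero] using this

end Periodic

end PureAcyclic

section Dimension

variable {R : Type u} [Ring R]

/-- A flat module periodic with respect to modules of projective dimension at most `n` has
projective dimension at most `n`. -/
theorem FactorsLocally.hasProjectiveDimensionLT_of_periodic (n : ℕ) :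
    ∀ {M A : Type u} [AddCommGroup M] [AddCommGroup A] [Module R M] [Module R A]
      {f : M →ₗ[R] A} {g : A →ₗ[R] M}, FactorsLocally R M → Function.Injective f →
      Function.Surjective g → Function.Exact f g →
      HasProjectiveDimensionLT (ModuleCat.of R A) (n + 1) →
      HasProjectiveDimensionLT (ModuleCat.of R M) (n + 1) := by
  induction n with
  | zero =>
    intro M A _ _ _ _ f g hM hf hg hfg hA
    rw [zero_add, ← projective_iff_hasProjectiveDimensionLT_one,
      ← IsProjective.iff_projective] at hA ⊢
    exact hM.projective_of_periodic hf hg hfg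
  | succ n ih =>
    intro M A _ _ _ _ f g hM hf hg hfg hA
    let π : (M →₀ R) →ₗ[R] M := Finsupp.linearCombination R id
    have hπ : Function.Surjective π := Finsupp.linearCombination_id_surjective R M
    obtain ⟨π', hπ'⟩ := Module.projective_lifting_property g π hg
    have hπ'a : ∀ x, g (π' x) = π x := fun x ↦ LinearMap.congr_fun hπ' x
    let πA : ((M →₀ R) × (M →₀ R)) →ₗ[R] A := (f ∘ₗ π).coprod π'
    have hπA : Function.Surjective πA := by
      intro a
      obtain ⟨y, hy⟩ := hπ (g a)
      obtain ⟨m, hm⟩ := (hfg (a - π' y)).1 (by rw [map_sub, hπ'a, hy, sub_self])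
      obtain ⟨x, rfl⟩ := hπ m
      exact ⟨(x, y), by simp [πA, hm]⟩
    have hSA := LinearMap.shortExact_shortComplexKer hπA
    have hSM := LinearMap.shortExact_shortComplexKer hπ
    have hPA : Projective (ModuleCat.of R ((M →₀ R) × (M →₀ R))) :=
      (IsProjective.iff_projective _).1 inferInstance
    have hPM : Projective (ModuleCat.of R (M →₀ R)) :=
      (IsProjective.iff_projective _).1 inferInstance
    refine (hSM.hasProjectiveDimensionLT_X₃_iff n hPM).2 ?_
    have hKA : HasProjectiveDimensionLT (ModuleCat.of R πA.ker) (n + 1) :=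
      (hSA.hasProjectiveDimensionLT_X₃_iff n hPA).1 hA
    let f' : π.ker →ₗ[R] πA.ker := (LinearMap.inl R _ _ ∘ₗ π.ker.subtype).codRestrict _ (by
      rintro ⟨x, hx⟩
      simp only [LinearMap.mem_ker] at hx
      simp [πA, hx])
    let g' : πA.ker →ₗ[R] π.ker := (LinearMap.snd R _ _ ∘ₗ πA.ker.subtype).codRestrict _ (by
      rintro ⟨⟨x, y⟩, hxy⟩
      simp only [LinearMap.mem_ker, πA, LinearMap.coprod_apply, LinearMap.comp_apply] at hxy
      have := congrArg g hxy
      simpa [hfg.apply_apply_eq_zero, hπ'a] using this)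
    refine ih (f := f') (g := g') (hM.of_exact π.ker.injective_subtype hπ ?_) ?_ ?_ ?_ hKA
    · exact LinearMap.exact_subtype_ker_map π
    · intro x y hxy
      exact Subtype.ext (congrArg (fun z : πA.ker ↦ z.1.1) hxy)
    · rintro ⟨y, hy⟩
      rw [LinearMap.mem_ker] at hy
      obtain ⟨m, hm⟩ := (hfg (π' y)).1 (by rw [hπ'a, hy])
      obtain ⟨x, rfl⟩ := hπ m
      exact ⟨⟨(-x, y), by simp [πA, hm]⟩, rfl⟩
    · rintro ⟨⟨x, y⟩, hxy⟩
      constructor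
      · intro h
        obtain rfl : y = 0 := congrArg Subtype.val h
        simp only [LinearMap.mem_ker, πA, LinearMap.coprod_apply, LinearMap.comp_apply,
          map_zero, add_zero] at hxy
        exact ⟨⟨x, hf (hxy.trans (map_zero f).symm)⟩, rfl⟩
      · rintro ⟨z, hz⟩
        exact Subtype.ext (congrArg (fun z : πA.ker ↦ z.1.2) hz).symm

end Dimension

/-- A filtered colimit of finitely generated free modules satisfies `FactorsLocally`. -/
lemma IsFlatModule.factorsLocally {R : Type u} [Ring R] {M : ModuleCat.{u} Rᵐᵒᵖ}
    (hM : IsFlatModule R M) : FactorsLocally Rᵐᵒᵖ M := by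
  classical
  obtain ⟨J, _, _, D, c, hD, ⟨hc⟩, ⟨e⟩⟩ := hM
  intro X φ t s hs
  have hcover : ∀ t' : Finset X, ∃ j : J, ∀ x ∈ t', ∃ y : D.obj j,
      e.hom (c.ι.app j y) = φ (Finsupp.single x 1) := by
    intro t'
    induction t' using Finset.induction_on with
    | empty => exact ⟨IsFiltered.nonempty.some, by simp⟩
    | insert a t' _ ih =>
      obtain ⟨j, hj⟩ := ih
      obtain ⟨k, y, hy⟩ := Concrete.isColimit_exists_rep D hc
        (e.inv (φ (Finsupp.single a 1)))
      refine ⟨IsFiltered.max j k, fun x hx ↦ ?_⟩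
      rcases Finset.mem_insert.1 hx with rfl | hx
      · refine ⟨D.map (IsFiltered.rightToMax j k) y, ?_⟩
        rw [← ConcreteCategory.comp_apply (D.map _), c.w, hy]
        simp
      · obtain ⟨z, hz⟩ := hj x hx
        refine ⟨D.map (IsFiltered.leftToMax j k) z, ?_⟩
        rw [← ConcreteCategory.comp_apply (D.map _), c.w, hz]
  obtain ⟨j, hj⟩ := hcover t
  have hex : ∀ x, ∃ y : D.obj j, x ∈ t → e.hom (c.ι.app j y) = φ (Finsupp.single x 1) := by
    intro x
    by_cases hx : x ∈ t
    · obtain ⟨y, hy⟩ := hj x hx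
      exact ⟨y, fun _ ↦ hy⟩
    · exact ⟨0, fun h ↦ absurd h hx⟩
  choose κ hκ using hex
  let θ : (X →₀ Rᵐᵒᵖ) →ₗ[Rᵐᵒᵖ] D.obj j := Finsupp.linearCombination Rᵐᵒᵖ κ
  let ψ : ∀ k, D.obj k →ₗ[Rᵐᵒᵖ] M := fun k ↦ (c.ι.app k ≫ e.hom).hom
  have hψ : ∀ {k l} (a : k ⟶ l) (y : D.obj k), ψ l (D.map a y) = ψ k y := by
    intro k l a y
    change e.hom (c.ι.app l (D.map a y)) = e.hom (c.ι.app k y)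
    rw [← ConcreteCategory.comp_apply (D.map _), c.w]
  have hθφ : ∀ v : X →₀ Rᵐᵒᵖ, v.support ⊆ t → ψ j (θ v) = φ v := by
    intro v hv
    exact LinearMap.congr_of_support_subset (F := ψ j ∘ₗ θ) hv fun x hx ↦ by
      simpa [θ, ψ] using hκ x hx
  have hkill : ∀ s' ⊆ s, ∃ (k : J) (a : j ⟶ k), ∀ v ∈ s', D.map a (θ v) = 0 := by
    intro s'
    induction s' using Finset.induction_on with
    | empty => exact fun _ ↦ ⟨j, 𝟙 j, by simp⟩
    | insert v s' _ ih =>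
      intro hs'
      obtain ⟨k, a, ha⟩ := ih fun w hw ↦ hs' (Finset.mem_insert_of_mem hw)
      have hv := hs v (hs' (Finset.mem_insert_self _ _))
      have h0 : c.ι.app k (D.map a (θ v)) = c.ι.app k 0 := by
        have h1 : ψ k (D.map a (θ v)) = 0 := by rw [hψ, hθφ v hv.2, hv.1]
        have h2 := congrArg e.inv h1
        simpa [ψ] using h2
      obtain ⟨l, b, b', hb⟩ := Concrete.isColimit_exists_of_rep_eq D hc _ _ h0
      refine ⟨l, a ≫ b, fun w hw ↦ ?_⟩
      rw [D.map_comp, ConcreteCategory.comp_apply]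
      rcases Finset.mem_insert.1 hw with rfl | hw
      · rw [hb, map_zero]
      · rw [ha w hw, map_zero]
  obtain ⟨k, a, ha⟩ := hkill s subset_rfl
  have := (hD k).2
  refine ⟨D.obj k, inferInstance, inferInstance, (D.map a).hom ∘ₗ θ, ψ k, inferInstance,
    ha, fun x hx ↦ ?_⟩
  refine (hψ a _).trans ?_
  simpa [θ, ψ] using hκ x hx

/-- If `0 → M → A → M → 0` is exact and `Ext^i(A, B) = 0` for `i ≥ 1`, then
`Ext^1(M, B)` vanishes as soon as some `Ext^(n+1)(M, B)` does. -/
lemma subsingleton_ext_one_of_periodic {C : Type u} [Category.{v} C] [Abelian C]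
    [HasExt.{w} C] {M A B : C} (hMAM : IsShortExactSeq M A M)
    (hA : ∀ i : ℕ, 1 ≤ i → Subsingleton (Abelian.Ext.{w} A B i)) (n : ℕ)
    (hn : Subsingleton (Abelian.Ext.{w} M B (n + 1))) : Subsingleton (Abelian.Ext.{w} M B 1) := by
  obtain ⟨f, g, hfg, hS⟩ := hMAM
  induction n with
  | zero => exact hn
  | succ n ih =>
    refine ih (subsingleton_of_forall_eq 0 fun x ↦ ?_)
    have := hA (n + 1) (by omega)
    obtain ⟨y, rfl⟩ := Abelian.Ext.contravariant_sequence_exact₁ hS B x (add_comm 1 (n + 1))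
      (Subsingleton.elim _ _)
    rw [Subsingleton.elim y 0, Abelian.Ext.comp_zero]

/-- for a complete hereditary cotorsion pair `(𝒜, ℬ)` with `𝒜` consisting of
flat modules of projective dimension at most `n`, every flat `𝒜`-periodic module belongs
to `𝒜`.  Right `R`-modules are modules over `Rᵐᵒᵖ`. -/
theorem stmt19 (R : Type u) [Ring R] [HasExt.{w} (ModuleCat.{u} Rᵐᵒᵖ)]
    (𝒜 ℬ : Set (ModuleCat.{u} Rᵐᵒᵖ))
    (hcp : IsCompleteHereditaryCotorsionPair (ModuleCat.{u} Rᵐᵒᵖ) 𝒜 ℬ)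
    (n : ℕ)
    -- every module in `𝒜` is flat:
    (hflat : ∀ A ∈ 𝒜, IsFlatModule R A)
    -- every module in `𝒜` has projective dimension at most `n`:
    (hpd : ∀ A ∈ 𝒜, ∀ (N : ModuleCat.{u} Rᵐᵒᵖ) (i : ℕ), n < i →
      Subsingleton (Abelian.Ext.{w} A N i))
    (M : ModuleCat.{u} Rᵐᵒᵖ) (hM : IsFlatModule R M)
    (A : ModuleCat.{u} Rᵐᵒᵖ) (hA : A ∈ 𝒜)
    -- `0 → M → A → M → 0` is exact:
    (hper : IsShortExactSeq M A M) :
    M ∈ 𝒜 := by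
  obtain ⟨f, g, w, hS⟩ := hper
  have hAdim : HasProjectiveDimensionLT A (n + 1) :=
    (hasProjectiveDimensionLT_iff.{w} A (n + 1)).2 fun i hi Y x ↦
      have := hpd A hA Y i hi
      Subsingleton.elim x 0
  have hMdim : HasProjectiveDimensionLT M (n + 1) :=
    hM.factorsLocally.hasProjectiveDimensionLT_of_periodic n
      ((ModuleCat.mono_iff_injective f).1 hS.mono_f)
      ((ModuleCat.epi_iff_surjective g).1 hS.epi_g)
      ((ShortComplex.ShortExact.moduleCat_exact_iff_function_exact _).1 hS.exact) hAdim
  rw [hcp.mem_left_iff]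
  exact fun B hB ↦ subsingleton_ext_one_of_periodic ⟨f, g, w, hS⟩ (hcp.hereditary A hA B hB) n
    (HasProjectiveDimensionLT.subsingleton M (n + 1) (n + 1) le_rfl B)
end
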